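/- Let k ≥ 1 be an integer and let H be a plane near-triangulation whose outer face is bounded by a cycle C with exactly 8k vertices, and suppose that for every pair of vertices u,v on C the distance between u and v in the graph H equals the distance between u and v along the cycle C. Then H contains a 0-nest of size k, i.e., k pairwise vertex-disjoint cycles C₁,…,C_k such that C_{i+1} is contained in the closed disk bounded by C_i for each i. -/

import Mathlib

open Set Bornology

noncomputable section

namespace CrossingPaper

/-- Points of the plane. -/
abbrev Plane : Type := ℝ × ℝ

/-- A drawing of a (simple) graph `G` in the plane: each vertex is mapped to a point
(injectively), and each edge `e = uv` is mapped to an arc with ends `vmap u`, `vmap v`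
whose interior `emap e` avoids all vertex images; any two distinct edges intersect in
finitely many points. -/
structure Drawing {V : Type} (G : SimpleGraph V) where
  vmap : V → Plane
  emap : Sym2 V → Set Plane
  vmap_inj : Function.Injective vmap
  arc : ∀ e ∈ G.edgeSet, ∀ u v : V, e = s(u, v) →
    ∃ f : ℝ → Plane, ContinuousOn f (Icc 0 1) ∧ InjOn f (Icc 0 1) ∧
      f 0 = vmap u ∧ f 1 = vmap v ∧ emap e = f '' Ioo 0 1
  avoid : ∀ e ∈ G.edgeSet, ∀ v : V, vmap v ∉ emap e
  finite_inter : ∀ e ∈ G.edgeSet, ∀ e' ∈ G.edgeSet, e ≠ e' → (emap e ∩ emap e').Finite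

variable {V : Type} {G : SimpleGraph V}

/-- The set of crossings of a drawing: points lying on (the interiors of) two distinct
edges. -/
def Drawing.crossings (γ : Drawing G) : Set Plane :=
  {p | ∃ e ∈ G.edgeSet, ∃ e' ∈ G.edgeSet, e ≠ e' ∧ p ∈ γ.emap e ∧ p ∈ γ.emap e'}

/-- The crossing number of a graph: the minimum number of crossings over all drawings. -/
def crossingNumber (G : SimpleGraph V) : ℕ :=
  sInf {n | ∃ γ : Drawing G, γ.crossings.Finite ∧ γ.crossings.ncard = n}

/-- `G` is `k`-crossing-critical: `cr(G) ≥ k` and `cr(G - e) < k` for every edge `e`. -/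
def CrossingCritical (G : SimpleGraph V) (k : ℕ) : Prop :=
  k ≤ crossingNumber G ∧
    ∀ e ∈ G.edgeSet, crossingNumber (G.deleteEdges {e}) < k

/-- The image of a subgraph under a drawing. -/
def Drawing.image (γ : Drawing G) (H : G.Subgraph) : Set Plane :=
  γ.vmap '' H.verts ∪ ⋃ e ∈ H.edgeSet, γ.emap e

/-- The image of a whole drawing. -/
def Drawing.totalImage (γ : Drawing G) : Set Plane :=
  range γ.vmap ∪ ⋃ e ∈ G.edgeSet, γ.emap e

/-- The union of all bounded complementary components of a set in the plane: for a
Jordan curve this is the open disk bounded by the curve. -/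
def boundedSide (s : Set Plane) : Set Plane :=
  {p | p ∉ s ∧ IsBounded (connectedComponentIn sᶜ p)}

/-- For a Jordan curve, the closed disk bounded by the curve. -/
def closedRegion (s : Set Plane) : Set Plane :=
  s ∪ boundedSide s

/-- A subgraph is a cycle: connected, finite, and every vertex has exactly two
neighbours. -/
def IsCycleSubgraph (H : G.Subgraph) : Prop :=
  H.Connected ∧ H.verts.Finite ∧ ∀ v ∈ H.verts, (H.neighborSet v).ncard = 2

/-- A subgraph is crossing-free in a drawing if none of its edges is crossed by
another edge of `G`. -/
def Drawing.CrossingFree (γ : Drawing G) (H : G.Subgraph) : Prop :=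
  ∀ e ∈ H.edgeSet, ∀ e' ∈ G.edgeSet, e ≠ e' → γ.emap e ∩ γ.emap e' = ∅

/-- A sequence of cycles `C 0, …, C (t-1)` is a nest in `γ`: the cycles are pairwise
edge-disjoint, each is crossing-free in `γ`, and the image of each cycle is contained
in the closed disk bounded by the image of the previous one. -/
def Drawing.IsNest (γ : Drawing G) {t : ℕ} (C : Fin t → G.Subgraph) : Prop :=
  (∀ i, IsCycleSubgraph (C i)) ∧
  (∀ i j, i ≠ j → Disjoint (C i).edgeSet (C j).edgeSet) ∧
  (∀ i, γ.CrossingFree (C i)) ∧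
  (∀ i : ℕ, ∀ h : i + 1 < t,
    γ.image (C ⟨i + 1, h⟩) ⊆ closedRegion (γ.image (C ⟨i, by omega⟩)))

/-- An `s`-nest: a nest such that any two distinct cycles intersect exactly in a fixed
set `X` of `s` vertices. -/
def Drawing.IsSNest (γ : Drawing G) (s : ℕ) {t : ℕ} (C : Fin t → G.Subgraph) : Prop :=
  γ.IsNest C ∧ ∃ X : Set V, X.Finite ∧ X.ncard = s ∧
    ∀ i j, i ≠ j → (C i).verts ∩ (C j).verts = X

/-- A nest `C 0, …, C (t-1)` in `γ` is clean if every crossing of `γ` lies either in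
the open disk bounded by the image of the last cycle or outside the closed disk
bounded by the image of the first cycle. -/
def Drawing.IsCleanNest (γ : Drawing G) {t : ℕ} (C : Fin t → G.Subgraph) : Prop :=
  ∀ h : 0 < t, ∀ p ∈ γ.crossings,
    p ∈ boundedSide (γ.image (C ⟨t - 1, by omega⟩)) ∨
      p ∉ closedRegion (γ.image (C ⟨0, h⟩))

/-- A drawing is generic: no point lies on three distinct edges, and no two adjacent
edges cross. -/
def Drawing.Generic (γ : Drawing G) : Prop :=
  (∀ p : Plane, ∀ e₁ ∈ G.edgeSet, ∀ e₂ ∈ G.edgeSet, ∀ e₃ ∈ G.edgeSet,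
    p ∈ γ.emap e₁ → p ∈ γ.emap e₂ → p ∈ γ.emap e₃ → e₁ = e₂ ∨ e₁ = e₃ ∨ e₂ = e₃) ∧
  (∀ e ∈ G.edgeSet, ∀ e' ∈ G.edgeSet, e ≠ e' → (∃ v : V, v ∈ e ∧ v ∈ e') →
    γ.emap e ∩ γ.emap e' = ∅)

/-- The faces of a (crossing-free) drawing: the connected components of the complement
of its image. -/
def Drawing.faces (γ : Drawing G) : Set (Set Plane) :=
  {F | ∃ x, x ∉ γ.totalImage ∧ F = connectedComponentIn γ.totalImageᶜ x}

/-- The length of (the boundary of) a face: the number of edges of the graph drawn on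
its frontier. -/
def Drawing.faceLength (γ : Drawing G) (F : Set Plane) : ℕ :=
  {e | e ∈ G.edgeSet ∧ γ.emap e ⊆ frontier F}.ncard

/-- A drawing is a plane triangulation if it has no crossings and every face (including
the outer face) is bounded by a triangle of the graph. -/
def Drawing.IsPlaneTriangulation (γ : Drawing G) : Prop :=
  γ.crossings = ∅ ∧
  ∀ F ∈ γ.faces, ∃ T : G.Subgraph, IsCycleSubgraph T ∧ T.verts.ncard = 3 ∧
    frontier F = γ.image T



/-- Identification of the plane with the complex numbers. -/
def zc (x : Plane) : ℂ := Complex.equivRealProdCLM.symm x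

lemma zc_cont : Continuous zc := Complex.equivRealProdCLM.symm.continuous

lemma zc_inj : Function.Injective zc := Complex.equivRealProdCLM.symm.injective

lemma zc_surj (z : ℂ) : ∃ x, zc x = z := ⟨Complex.equivRealProdCLM z, Complex.equivRealProdCLM.symm_apply_apply z⟩

lemma zc_ne {x y : Plane} (h : x ≠ y) : zc x - zc y ≠ 0 := sub_ne_zero.2 (fun h' => h (zc_inj h'))

lemma lift_homotopy {A : Type*} [TopologicalSpace A] (F : unitInterval × A → ℂ) (hF : Continuous F)
    (hne : ∀ q, F q ≠ 0) (f0 : A → ℂ) (hf0 : Continuous f0)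
    (h0 : ∀ a, Complex.exp (f0 a) = F (0, a)) :
    ∃ g : unitInterval × A → ℂ, Continuous g ∧ (∀ q, Complex.exp (g q) = F q) ∧
      ∀ a, g (0, a) = f0 a := by
  have cov := Complex.isCoveringMap_exp
  let F' : C(unitInterval × A, {z : ℂ // z ≠ 0}) := ⟨fun q => ⟨F q, hne q⟩, by fun_prop⟩
  let f' : C(A, ℂ) := ⟨f0, hf0⟩
  have H0 : ∀ a, F' (0, a) = ⟨_, (f' a).exp_ne_zero⟩ := by
    intro a; apply Subtype.ext; simp [F', f', h0]
  refine ⟨cov.liftHomotopy F' f' H0, (cov.liftHomotopy F' f' H0).continuous, ?_, ?_⟩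
  · intro q
    have := congrFun (cov.liftHomotopy_lifts F' f' H0) q
    exact congrArg Subtype.val this
  · intro a
    exact cov.liftHomotopy_zero F' f' H0 a

lemma exp_eq_const {X : Type*} [TopologicalSpace X] {S : Set X} (hS : IsPreconnected S)
    {h1 h2 : X → ℂ} (c1 : ContinuousOn h1 S)
    (c2 : ContinuousOn h2 S) (he : ∀ x ∈ S, Complex.exp (h1 x) = Complex.exp (h2 x))
    {x y : X} (hx : x ∈ S) (hy : y ∈ S) : h1 x - h2 x = h1 y - h2 y := by
  have key : ∀ z ∈ S, ∃ n : ℤ, h1 z - h2 z = n * (2 * Real.pi * Complex.I) := by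
    intro z hz
    obtain ⟨n, hn⟩ := Complex.exp_eq_exp_iff_exists_int.1 (he z hz)
    exact ⟨n, by rw [hn]; ring⟩
  have hT : DiscreteTopology (range ((↑) : ℤ → ℝ)) := by
    exact (Int.isClosedEmbedding_coe_real.isEmbedding.toHomeomorph).symm.isEmbedding.discreteTopology
  have := hS.constant_of_mapsTo (T := range ((↑) : ℤ → ℝ)) (f := fun z => (h1 z - h2 z).im / (2 * Real.pi))
    hT.isDiscrete (by fun_prop) (by
      intro z hz
      obtain ⟨n, hn⟩ := key z hz
      refine ⟨n, ?_⟩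
      have : (2 * Real.pi) ≠ 0 := by positivity
      simp only [hn]
      simp) hx hy
  obtain ⟨n, hn⟩ := key x hx
  obtain ⟨m, hm⟩ := key y hy
  simp only [hn, hm] at this
  rw [hn, hm]
  have h2 : (2 * Real.pi) ≠ 0 := by positivity
  simp at this
  rw [show (n : ℂ) = m by exact_mod_cast this]

lemma no_log_circle (a : ℂ) (r : ℝ) (hr : 0 < r) (g : ℂ → ℂ)
    (hg : ContinuousOn g (Metric.sphere a r))
    (he : ∀ z ∈ Metric.sphere a r, Complex.exp (g z) = z - a) : False := by
  let c : ℝ → ℂ := fun θ => a + r * Complex.exp (θ * Complex.I)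
  have hc : ∀ θ, c θ ∈ Metric.sphere a r := by
    intro θ
    simp [c, Complex.norm_exp_ofReal_mul_I, abs_of_pos hr]
  have hr' : (r : ℂ) ≠ 0 := by exact_mod_cast hr.ne'
  have := exp_eq_const (S := (univ : Set ℝ)) isPreconnected_univ (h1 := fun θ => g (c θ))
    (h2 := fun θ => Complex.log r + θ * Complex.I)
    (by
      apply hg.comp (by fun_prop) (fun θ _ => hc θ)) (by fun_prop) (by
      intro θ _
      rw [he _ (hc θ), Complex.exp_add, Complex.exp_log hr']
      simp [c]) (mem_univ (0 : ℝ)) (mem_univ (2 * Real.pi))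
  have h2 : c (2 * Real.pi) = c 0 := by
    simp [c, Complex.exp_two_pi_mul_I]
  rw [h2] at this
  simp at this

lemma no_ext (p : Plane) (Φ : Plane → ℂ) (hΦ : Continuous Φ) (hne : ∀ x, Φ x ≠ 0)
    (B : Set Plane) (hB : IsBounded B) (h : ∀ x ∉ B, Φ x = zc x - zc p) : False := by
  obtain ⟨g, hg, hge, -⟩ := lift_homotopy (fun q : unitInterval × Plane => Φ ((q.1 : ℝ) • q.2))
    (by fun_prop) (fun q => hne _) (fun _ => Complex.log (Φ 0)) (by fun_prop)
    (by intro a; simp [Complex.exp_log (hne 0)])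
  obtain ⟨R, hR⟩ := (Complex.equivRealProdCLM.symm.lipschitz.isBounded_image hB).subset_closedBall (zc p)
  have hR1 : 0 < max R 0 + 1 := by positivity
  apply no_log_circle (zc p) (max R 0 + 1) hR1
    (fun z => g (1, Complex.equivRealProdCLM z))
  · apply Continuous.continuousOn; fun_prop
  · intro z hz
    obtain ⟨x, rfl⟩ := zc_surj z
    have hx : x ∉ B := by
      intro hx
      have := hR (mem_image_of_mem _ hx)
      simp only [Metric.mem_closedBall] at this
      simp only [Metric.mem_sphere] at hz
      have h3 := le_max_left R 0
      change dist (zc x) _ ≤ _ at this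
      linarith
    have := hge (1, x)
    simp only [Complex.exp] at *
    have e : Complex.equivRealProdCLM (zc x) = x := by simp [zc]
    rw [e, this]
    simp [h x hx]

/-- `z - p` has a continuous logarithm on `S`. -/
def HasLog (p : Plane) (S : Set Plane) : Prop :=
  ∃ g : Plane → ℂ, ContinuousOn g S ∧ ∀ x ∈ S, Complex.exp (g x) = zc x - zc p

lemma tietze {S : Set Plane} (hS : IsClosed S) {g : Plane → ℂ} (hg : ContinuousOn g S) :
    ∃ G : Plane → ℂ, Continuous G ∧ ∀ x ∈ S, G x = g x := by
  obtain ⟨G, hG⟩ := ContinuousMap.exists_restrict_eq hS ⟨S.domRestrict g, hg.domRestrict⟩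
  refine ⟨G, G.continuous, fun x hx => ?_⟩
  exact congrArg (fun f => f ⟨x, hx⟩) hG

lemma closure_comp_subset {S : Set Plane} {p : Plane} :
    closure (connectedComponentIn Sᶜ p) ⊆ connectedComponentIn Sᶜ p ∪ S := by
  intro y hy
  by_cases hyS : y ∈ S
  · exact Or.inr hyS
  left
  by_cases hp : p ∈ Sᶜ
  · have h1 : IsPreconnected (insert y (connectedComponentIn Sᶜ p)) :=
      isPreconnected_connectedComponentIn.subset_closure (subset_insert _ _)
        (insert_subset hy subset_closure)
    exact h1.subset_connectedComponentIn (mem_insert_of_mem _ (mem_connectedComponentIn hp))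
      (insert_subset hyS (connectedComponentIn_subset _ _)) (mem_insert _ _)
  · rw [connectedComponentIn_eq_empty hp] at hy
    simp at hy

lemma not_hasLog {S : Set Plane} (hS : IsClosed S) {p : Plane} (hp : p ∈ boundedSide S) :
    ¬ HasLog p S := by
  classical
  rintro ⟨g, hg, hge⟩
  obtain ⟨G, hG, hGe⟩ := tietze hS hg
  set U := connectedComponentIn Sᶜ p with hU
  have hUo : IsOpen U := hS.isOpen_compl.connectedComponentIn
  have hpU : p ∈ U := mem_connectedComponentIn hp.1
  have hfr : frontier U ⊆ S := by
    intro y hy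
    rw [frontier, hUo.interior_eq] at hy
    exact (closure_comp_subset hy.1).resolve_left hy.2
  refine no_ext p (U.piecewise (fun x => Complex.exp (G x)) (fun x => zc x - zc p)) ?_ ?_ U hp.2 ?_
  · apply Continuous.piecewise
    · intro x hx
      have := hfr hx
      rw [hGe x this, hge x this]
    · fun_prop
    · have := zc_cont
      fun_prop
  · intro x
    by_cases hx : x ∈ U
    · simp [hx, Complex.exp_ne_zero]
    · simp only [Set.piecewise, hx, if_false]
      apply zc_ne
      rintro rfl; exact hx hpU
  · intro x hx
    simp [hx]

lemma hasLog_far {S : Set Plane} {q : Plane} {M : ℝ} (hS : ∀ x ∈ S, ‖zc x‖ ≤ M) (hq : M < ‖zc q‖) :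
    HasLog q S := by
  rcases S.eq_empty_or_nonempty with rfl | ⟨x0, hx0⟩
  · exact ⟨0, by simp, by simp⟩
  have hM : 0 ≤ M := (norm_nonneg _).trans (hS x0 hx0)
  have hq0 : zc q ≠ 0 := by intro h; rw [h] at hq; simp at hq; linarith
  refine ⟨fun x => Complex.log (- zc q) + Complex.log (1 - zc x / zc q), ?_, ?_⟩
  · have hmem : ∀ x ∈ S, 1 - zc x / zc q ∈ Complex.slitPlane := by
      intro x hx
      rw [sub_eq_add_neg]
      apply Complex.mem_slitPlane_of_norm_lt_one
      rw [norm_neg, norm_div, div_lt_one (by linarith)]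
      linarith [hS x hx]
    have := zc_cont
    apply ContinuousOn.add continuousOn_const
    apply ContinuousOn.clog _ hmem
    fun_prop
  · intro x hx
    have : 1 - zc x / zc q ≠ 0 := by
      intro h
      have h2 : zc x = zc q := by field_simp at h; linear_combination -h
      have := hS x hx
      rw [h2] at this; linarith
    rw [Complex.exp_add, Complex.exp_log this, Complex.exp_log (by simpa using hq0)]
    field_simp; ring

lemma hasLog_near {S : Set Plane} {q q' : Plane} {r : ℝ} (hS : ∀ x ∈ S, r ≤ ‖zc x - zc q‖)
    (hq : ‖zc q - zc q'‖ < r) (h : HasLog q S) : HasLog q' S := by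
  obtain ⟨g, hg, hge⟩ := h
  have hr : 0 < r := (norm_nonneg _).trans_lt hq
  have h0 : ∀ x ∈ S, zc x - zc q ≠ 0 := by
    intro x hx h
    have := hS x hx
    rw [h] at this; simp at this; linarith
  have hmem : ∀ x ∈ S, 1 + (zc q - zc q') / (zc x - zc q) ∈ Complex.slitPlane := by
    intro x hx
    apply Complex.mem_slitPlane_of_norm_lt_one
    rw [norm_div, div_lt_one (norm_pos_iff.2 (h0 x hx))]
    linarith [hS x hx]
  refine ⟨fun x => g x + Complex.log (1 + (zc q - zc q') / (zc x - zc q)), ?_, ?_⟩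
  · have := zc_cont
    apply hg.add
    apply ContinuousOn.clog _ hmem
    apply ContinuousOn.add continuousOn_const
    apply ContinuousOn.div continuousOn_const (by fun_prop) h0
  · intro x hx
    have := h0 x hx
    rw [Complex.exp_add, hge x hx, Complex.exp_log (Complex.slitPlane_ne_zero (hmem x hx))]
    field_simp; ring

lemma hasLog_of_unbounded {S : Set Plane} (hS : IsCompact S) {p : Plane}
    (hp : ¬ IsBounded (connectedComponentIn Sᶜ p)) : HasLog p S := by
  have hpS : p ∈ Sᶜ := by
    by_contra h
    rw [connectedComponentIn_eq_empty h] at hp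
    exact hp isBounded_empty
  set U := connectedComponentIn Sᶜ p with hU
  -- a uniform local statement
  have hloc : ∀ q ∈ Sᶜ, ∃ V : Set Plane, IsOpen V ∧ q ∈ V ∧ ∀ q' ∈ V, (HasLog q S ↔ HasLog q' S) := by
    intro q hq
    obtain ⟨r, hr, hrS⟩ : ∃ r > 0, ∀ x ∈ S, 2 * r ≤ ‖zc x - zc q‖ := by
      rcases S.eq_empty_or_nonempty with rfl | hne
      · exact ⟨1, one_pos, by simp⟩
      obtain ⟨x0, hx0, hmin⟩ := hS.exists_isMinOn hne (f := fun x => ‖zc x - zc q‖)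
        (by have := zc_cont; fun_prop)
      refine ⟨‖zc x0 - zc q‖ / 2, ?_, ?_⟩
      · have : 0 < ‖zc x0 - zc q‖ := norm_pos_iff.2 (zc_ne (by rintro rfl; exact hq hx0))
        positivity
      · intro x hx
        have := hmin hx
        simp only [mem_ofPred_eq] at this
        linarith
    refine ⟨{q' | ‖zc q - zc q'‖ < r}, ?_, by simpa using hr, ?_⟩
    · have := zc_cont
      exact isOpen_lt (by fun_prop) continuous_const
    · intro q' hq'
      simp only [mem_ofPred_eq] at hq'
      refine ⟨hasLog_near hrS (by linarith), hasLog_near (r := r) ?_ (by rwa [norm_sub_rev])⟩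
      intro x hx
      have h1 := hrS x hx
      have h2 : zc x - zc q = (zc x - zc q') - (zc q - zc q') := by ring
      have h3 := norm_sub_le (zc x - zc q') (zc q - zc q')
      rw [← h2] at h3
      linarith
  obtain ⟨M, hM⟩ : ∃ M, ∀ x ∈ S, ‖zc x‖ ≤ M := by
    obtain ⟨M, hM⟩ := (hS.image zc_cont).isBounded.exists_norm_le
    exact ⟨M, fun x hx => hM _ (mem_image_of_mem _ hx)⟩
  obtain ⟨q, hqU, hq⟩ : ∃ q ∈ U, M < ‖zc q‖ := by
    by_contra! hcon
    apply hp
    have : IsBounded (zc '' U) := by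
      rw [isBounded_iff_forall_norm_le]
      exact ⟨M, by rintro _ ⟨x, hx, rfl⟩; exact hcon x hx⟩
    have h2 := Complex.equivRealProdCLM.lipschitz.isBounded_image this
    rw [image_image] at h2
    simpa [zc] using h2
  have hql := hasLog_far hM hq
  -- connectedness
  by_contra hpn
  have hpre : IsPreconnected U := isPreconnected_connectedComponentIn
  choose! V hVo hVm hVi using hloc
  let A := ⋃ q ∈ {q ∈ Sᶜ | HasLog q S}, V q
  let B := ⋃ q ∈ {q ∈ Sᶜ | ¬ HasLog q S}, V q
  obtain ⟨y, hyU, hyA, hyB⟩ := hpre A B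
    (isOpen_biUnion fun q hq => hVo q hq.1) (isOpen_biUnion fun q hq => hVo q hq.1)
    (by
      intro y hy
      have hyS := connectedComponentIn_subset _ _ hy
      by_cases h : HasLog y S
      · left; exact mem_biUnion (show y ∈ {q ∈ Sᶜ | HasLog q S} from ⟨hyS, h⟩) (hVm y hyS)
      · right; exact mem_biUnion (show y ∈ {q ∈ Sᶜ | ¬ HasLog q S} from ⟨hyS, h⟩) (hVm y hyS))
    ⟨q, hqU, by
      have hqS := connectedComponentIn_subset _ _ hqU
      exact mem_biUnion (show q ∈ {q ∈ Sᶜ | HasLog q S} from ⟨hqS, hql⟩) (hVm q hqS)⟩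
    ⟨p, mem_connectedComponentIn hpS,
      mem_biUnion (show p ∈ {q ∈ Sᶜ | ¬ HasLog q S} from ⟨hpS, hpn⟩) (hVm p hpS)⟩
  simp only [A, B, mem_iUnion] at hyA hyB
  obtain ⟨a, ha, hya⟩ := hyA
  obtain ⟨b, hb, hyb⟩ := hyB
  exact hb.2 ((hVi b hb.1 y hyb).2 ((hVi a ha.1 y hya).1 ha.2))


lemma exists_ext {S : Set Plane} (g : S → ℂ) (hg : Continuous g) :
    ∃ G : Plane → ℂ, ContinuousOn G S ∧ ∀ x : S, G x = g x := by
  classical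
  refine ⟨fun x => if h : x ∈ S then g ⟨x, h⟩ else 0, ?_, fun x => by simp⟩
  rw [continuousOn_iff_continuous_domRestrict]
  convert hg using 1
  ext x; simp

lemma path_log {f : ℝ → Plane} (hf : ContinuousOn f (Icc 0 1)) :
    ∃ g : Plane → ℂ, ContinuousOn g (f '' Icc 0 1)ᶜ ∧ ∀ x ∉ f '' Icc 0 1,
      Complex.exp (g x) = (zc x - zc (f 1)) / (zc x - zc (f 0)) := by
  have hz := zc_cont
  have hf' : Continuous (fun t : unitInterval => f t) := hf.domRestrict
  have hmem : ∀ t : unitInterval, f t ∈ f '' Icc 0 1 := fun t => mem_image_of_mem _ t.2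
  have hne : ∀ (t : unitInterval) (x : ↥(f '' Icc 0 1)ᶜ), zc x - zc (f t) ≠ 0 := by
    intro t x
    apply zc_ne
    intro h
    exact x.2 (h ▸ hmem t)
  obtain ⟨g, hg, hge, -⟩ := lift_homotopy
    (fun q : unitInterval × ↥(f '' Icc 0 1)ᶜ => (zc q.2 - zc (f q.1)) / (zc q.2 - zc (f (0 : unitInterval))))
    (by
      apply Continuous.div _ _ (fun q => hne _ _)
      · exact (hz.comp (continuous_subtype_val.comp continuous_snd)).sub
          (hz.comp (hf'.comp continuous_fst))
      · fun_prop) (fun q => div_ne_zero (hne _ _) (hne _ _)) (fun _ => 0) (by fun_prop)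
    (by intro a; simpa using (div_self (hne 0 a)).symm)
  obtain ⟨G, hG, hGe⟩ := exists_ext (fun x => g (1, x)) (by fun_prop)
  refine ⟨G, hG, fun x hx => ?_⟩
  rw [hGe ⟨x, hx⟩, hge]
  simp

lemma separation {X Y : Set Plane} (hX : IsClosed X) (hY : IsClosed Y) {a b : Plane} (hab : a ≠ b)
    (hXY : X ∩ Y = {a, b}) (hne : ((X ∪ Y)ᶜ).Nonempty) {gX gY : Plane → ℂ} (cX : ContinuousOn gX Xᶜ) (cY : ContinuousOn gY Yᶜ)
    (eX : ∀ x ∉ X, Complex.exp (gX x) = (zc x - zc a) / (zc x - zc b))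
    (eY : ∀ x ∉ Y, Complex.exp (gY x) = (zc x - zc a) / (zc x - zc b)) :
    ¬ IsPreconnected (X ∪ Y)ᶜ := by
  classical
  intro hpre
  have hsX : (X ∪ Y)ᶜ ⊆ Xᶜ := compl_subset_compl.2 subset_union_left
  have hsY : (X ∪ Y)ᶜ ⊆ Yᶜ := compl_subset_compl.2 subset_union_right
  obtain ⟨c, hc⟩ : ∃ c : ℂ, ∀ x ∈ (X ∪ Y)ᶜ, gX x - gY x = c := by
    rcases ((X ∪ Y)ᶜ).eq_empty_or_nonempty with h | ⟨x0, hx0⟩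
    · exact ⟨0, by simp [h]⟩
    · exact ⟨gX x0 - gY x0, fun x hx => exp_eq_const hpre (cX.mono hsX) (cY.mono hsY)
        (fun y hy => by rw [eX y (hsX hy), eY y (hsY hy)]) hx hx0⟩
  -- a log on the complement of `{a, b}`
  obtain ⟨L, cL, eL⟩ : ∃ L : Plane → ℂ, ContinuousOn L {a, b}ᶜ ∧
      ∀ x ∈ ({a, b} : Set Plane)ᶜ, Complex.exp (L x) = (zc x - zc a) / (zc x - zc b) := by
    obtain ⟨x0, hx0⟩ := hne
    have hexpc : Complex.exp c = 1 := by
      rw [← hc x0 hx0, Complex.exp_sub, eX x0 (hsX hx0), eY x0 (hsY hx0), div_self]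
      rw [← eX x0 (hsX hx0)]
      exact Complex.exp_ne_zero _
    refine ⟨fun x => if x ∈ X then gY x + c else gX x, ?_, ?_⟩
    · rw [← hXY, compl_inter]
      apply ContinuousOn.union_of_isOpen _ _ hX.isOpen_compl hY.isOpen_compl
      · apply cX.congr
        intro x hx
        simp only [mem_compl_iff] at hx
        simp [hx]
      · apply (cY.add (continuousOn_const (c := c))).congr
        intro x hx
        by_cases h : x ∈ X
        · simp [h]
        · simp only [h, if_false]
          have := hc x (fun h' => h'.elim h hx)
          rw [← this]; simp
    · intro x hx
      rw [← hXY] at hx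
      by_cases h : x ∈ X
      · have hY' : x ∉ Y := fun h' => hx ⟨h, h'⟩
        simp only [h, if_true]
        rw [Complex.exp_add, hexpc, eY x hY', mul_one]
      · simp only [h, if_false]
        exact eX x h
  -- small circle around `a`
  have hab' : 0 < ‖zc a - zc b‖ := norm_pos_iff.2 (zc_ne hab)
  have h0 : zc a - zc b ≠ 0 := zc_ne hab
  set r := ‖zc a - zc b‖ / 2 with hr
  let inv : ℂ → Plane := Complex.equivRealProdCLM
  have hinv : ∀ z, zc (inv z) = z := fun z => Complex.equivRealProdCLM.symm_apply_apply z
  have hinvc : Continuous inv := Complex.equivRealProdCLM.continuous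
  have hsl : ∀ z ∈ Metric.sphere (zc a) r, 1 + (z - zc a) / (zc a - zc b) ∈ Complex.slitPlane := by
    intro z hz
    apply Complex.mem_slitPlane_of_norm_lt_one
    rw [mem_sphere_iff_norm] at hz
    rw [norm_div, hz, div_lt_one hab']
    linarith
  have hzab : ∀ z ∈ Metric.sphere (zc a) r, inv z ∈ ({a, b} : Set Plane)ᶜ := by
    intro z hz
    rw [mem_sphere_iff_norm] at hz
    simp only [mem_compl_iff, mem_insert_iff, mem_singleton_iff, not_or]
    constructor
    · intro h
      have h2 := hinv z
      rw [h] at h2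
      rw [h2] at hz
      simp at hz; linarith
    · intro h
      have h2 := hinv z
      rw [h] at h2
      rw [← h2, norm_sub_rev] at hz
      linarith
  apply no_log_circle (zc a) r (by positivity)
    (fun z => L (inv z) + (Complex.log (zc a - zc b) + Complex.log (1 + (z - zc a) / (zc a - zc b))))
  · apply ContinuousOn.add
    · exact cL.comp hinvc.continuousOn hzab
    · apply continuousOn_const.add
      apply ContinuousOn.clog _ hsl
      fun_prop
  · intro z hz
    have hzb : z - zc b ≠ 0 := by
      intro h
      have h3 : z = zc b := sub_eq_zero.1 h
      have := hzab z hz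
      apply this
      right
      apply zc_inj
      rw [hinv, h3]
    rw [Complex.exp_add, Complex.exp_add, eL _ (hzab z hz), hinv, Complex.exp_log h0,
      Complex.exp_log (Complex.slitPlane_ne_zero (hsl z hz))]
    field_simp
    ring

lemma far_preconnected (R : ℝ) : IsPreconnected {x : Plane | R < ‖x‖} := by
  by_cases hR : R < 0
  · have : {x : Plane | R < ‖x‖} = univ := by
      ext x; simp; linarith [norm_nonneg x]
    rw [this]; exact isPreconnected_univ
  push Not at hR
  have h1 : IsPreconnected ({0}ᶜ : Set Plane) :=
    (isConnected_compl_singleton_of_one_lt_rank (by simp; norm_num) 0).isPreconnected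
  have h2 : {x : Plane | R < ‖x‖} = (fun x : Plane => ((R + ‖x‖) / ‖x‖) • x) '' {0}ᶜ := by
    ext x
    simp only [mem_ofPred_eq, mem_image, mem_compl_iff, mem_singleton_iff]
    constructor
    · intro hx
      have hx0 : 0 < ‖x‖ := by linarith
      refine ⟨((‖x‖ - R) / ‖x‖) • x, ?_, ?_⟩
      · intro h
        rw [smul_eq_zero] at h
        rcases h with h | h
        · have : ‖x‖ - R = 0 := by
            field_simp at h; simpa using h
          linarith
        · rw [h] at hx0; simp at hx0
      · have hn : ‖((‖x‖ - R) / ‖x‖) • x‖ = ‖x‖ - R := by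
          rw [norm_smul, norm_div, norm_norm, Real.norm_of_nonneg (by linarith)]
          field_simp
        rw [hn, smul_smul]
        have h3 : ‖x‖ - R ≠ 0 := by linarith
        have : (R + (‖x‖ - R)) / (‖x‖ - R) * ((‖x‖ - R) / ‖x‖) = 1 := by
          field_simp; ring
        rw [this, one_smul]
    · rintro ⟨y, hy, rfl⟩
      have hy0 : 0 < ‖y‖ := norm_pos_iff.2 hy
      rw [norm_smul, norm_div, norm_norm, Real.norm_of_nonneg (by linarith)]
      field_simp
      linarith
  rw [h2]
  apply h1.image
  refine ContinuousOn.fun_smul ?_ continuousOn_id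
  apply ContinuousOn.div (by fun_prop) (by fun_prop)
  intro x hx
  simpa using hx

lemma meet_frontier {S F : Set Plane} (hS : IsPreconnected S) (h1 : (S ∩ F).Nonempty)
    (h2 : (S ∩ Fᶜ).Nonempty) : (S ∩ frontier F).Nonempty := by
  by_contra h
  rw [not_nonempty_iff_eq_empty] at h
  have hcov : S ⊆ interior F ∪ (closure F)ᶜ := by
    intro x hx
    by_contra hx'
    simp only [mem_union, mem_compl_iff, not_or, not_not] at hx'
    have : x ∈ S ∩ frontier F := ⟨hx, hx'.2, hx'.1⟩
    rw [h] at this; exact this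
  obtain ⟨a, ha, haF⟩ := h1
  obtain ⟨b, hb, hbF⟩ := h2
  obtain ⟨y, -, hy1, hy2⟩ := hS _ _ isOpen_interior isClosed_closure.isOpen_compl hcov
    ⟨a, ha, (hcov ha).resolve_right (fun h' => h' (subset_closure haF))⟩
    ⟨b, hb, (hcov hb).resolve_left (fun h' => hbF (interior_subset h'))⟩
  exact hy2 (subset_closure (interior_subset hy1))

lemma closure_sUnion_comp {FF : Set (Set Plane)} {Y : Set Plane} (hY : IsClosed Y)
    (hF : ∀ F ∈ FF, frontier F ⊆ Y) : IsClosed (⋃₀ FF ∪ Y) := by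
  rw [← isOpen_compl_iff, Metric.isOpen_iff]
  intro y hy
  simp only [compl_union, mem_inter_iff, mem_compl_iff] at hy
  obtain ⟨ε, hε, hb⟩ := Metric.isOpen_iff.1 hY.isOpen_compl y hy.2
  refine ⟨ε, hε, ?_⟩
  intro z hz
  simp only [compl_union, mem_inter_iff, mem_compl_iff]
  refine ⟨?_, hb hz⟩
  rintro ⟨F, hFF, hzF⟩
  apply hy.1
  refine ⟨F, hFF, ?_⟩
  have hpre : IsPreconnected (Metric.ball y ε) := (convex_ball y ε).isPreconnected
  by_contra hyF
  obtain ⟨w, hw, hwF⟩ := meet_frontier (F := F) hpre ⟨z, hz, hzF⟩ ⟨y, Metric.mem_ball_self hε, hyF⟩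
  exact hb hw (hF F hFF hwF)

lemma arc_coord {f : ℝ → Plane} (hf : ContinuousOn f (Icc 0 1)) (hi : InjOn f (Icc 0 1)) :
    ∃ τ : Plane → ℝ, ContinuousOn τ (f '' Icc 0 1) ∧ ∀ t ∈ Icc (0:ℝ) 1, τ (f t) = t := by
  refine ⟨Function.invFunOn f (Icc 0 1), ?_, fun t ht => hi.leftInvOn_invFunOn ht⟩
  rw [continuousOn_iff_isClosed]
  intro T hT
  refine ⟨f '' (T ∩ Icc 0 1), ?_, ?_⟩
  · apply IsCompact.isClosed
    apply IsCompact.image_of_continuousOn (isCompact_Icc.inter_left hT) (hf.mono inter_subset_right)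
  · ext x
    constructor
    · rintro ⟨h1, t, ht, rfl⟩
      refine ⟨⟨t, ⟨?_, ht⟩, rfl⟩, ⟨t, ht, rfl⟩⟩
      have : Function.invFunOn f (Icc 0 1) (f t) = t := hi.leftInvOn_invFunOn ht
      simpa [this] using h1
    · rintro ⟨⟨t, ⟨hT', ht⟩, rfl⟩, h⟩
      refine ⟨?_, h⟩
      have : Function.invFunOn f (Icc 0 1) (f t) = t := hi.leftInvOn_invFunOn ht
      simpa [this] using hT'

lemma arc_hasLog {f : ℝ → Plane} (hf : ContinuousOn f (Icc 0 1)) (hi : InjOn f (Icc 0 1)) {p : Plane}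
    (hp : p ∉ f '' Icc 0 1) : HasLog p (f '' Icc 0 1) := by
  obtain ⟨τ, hτ, hτe⟩ := arc_coord hf hi
  have hz := zc_cont
  have hf' : Continuous (fun t : unitInterval => f t) := hf.domRestrict
  have hne : ∀ (t : unitInterval), zc (f t) - zc p ≠ 0 := by
    intro t
    apply zc_ne
    rintro rfl
    exact hp (mem_image_of_mem _ t.2)
  obtain ⟨g, hg, hge, -⟩ := lift_homotopy
    (fun q : unitInterval × Unit => (zc (f q.1) - zc p))
    ((hz.comp (hf'.comp continuous_fst)).sub continuous_const) (fun q => hne _) (fun _ => Complex.log (zc (f 0) - zc p)) (by fun_prop)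
    (by intro a; simpa using Complex.exp_log (hne 0))
  have hpr : Continuous (fun s : ℝ => g (projIcc 0 1 zero_le_one s, ())) := by
    fun_prop
  refine ⟨fun x => g (projIcc 0 1 zero_le_one (τ x), ()), ?_, ?_⟩
  · exact hpr.comp_continuousOn hτ
  · rintro _ ⟨t, ht, rfl⟩
    rw [hge, hτe t ht, projIcc_of_mem zero_le_one ht]


section drawing
variable {V : Type} {H : SimpleGraph V} (γ : Drawing H)

/-- The closed edge: an edge with its ends. -/
def cle (e : Sym2 V) : Set Plane := γ.emap e ∪ γ.vmap '' {v | v ∈ e}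

lemma cle_arc {u v : V} (h : H.Adj u v) : ∃ f : ℝ → Plane, ContinuousOn f (Icc 0 1) ∧
    InjOn f (Icc 0 1) ∧ f 0 = γ.vmap u ∧ f 1 = γ.vmap v ∧ cle γ s(u, v) = f '' Icc 0 1 := by
  obtain ⟨f, h1, h2, h3, h4, h5⟩ := γ.arc s(u, v) h u v rfl
  refine ⟨f, h1, h2, h3, h4, ?_⟩
  have hI : Icc (0:ℝ) 1 = Ioo 0 1 ∪ {0, 1} := (Ioo_union_both zero_le_one).symm
  have hs : {w : V | w ∈ s(u, v)} = {u, v} := by ext w; simp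
  rw [cle, h5, hI, image_union, image_pair, h3, h4, hs, image_pair]

lemma vmap_mem_cle {e : Sym2 V} {v : V} (h : v ∈ e) : γ.vmap v ∈ cle γ e :=
  Or.inr ⟨v, h, rfl⟩

lemma cle_compact {e : Sym2 V} (he : e ∈ H.edgeSet) : IsCompact (cle γ e) := by
  induction e with
  | h u v =>
    obtain ⟨f, h1, h2, h3, h4, h5⟩ := cle_arc γ he
    rw [h5]
    exact isCompact_Icc.image_of_continuousOn h1

lemma cle_preconnected {e : Sym2 V} (he : e ∈ H.edgeSet) : IsPreconnected (cle γ e) := by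
  induction e with
  | h u v =>
    obtain ⟨f, h1, h2, h3, h4, h5⟩ := cle_arc γ he
    rw [h5]
    exact isPreconnected_Icc.image _ h1

lemma cle_hasLog {e : Sym2 V} (he : e ∈ H.edgeSet) {p : Plane} (hp : p ∉ cle γ e) :
    HasLog p (cle γ e) := by
  induction e with
  | h u v =>
    obtain ⟨f, h1, h2, h3, h4, h5⟩ := cle_arc γ he
    rw [h5] at hp ⊢
    exact arc_hasLog h1 h2 hp

lemma cle_interp {u v : V} (h : H.Adj u v) (x y : ℂ) : ∃ g : Plane → ℂ,
    ContinuousOn g (cle γ s(u, v)) ∧ g (γ.vmap u) = x ∧ g (γ.vmap v) = y := by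
  obtain ⟨f, h1, h2, h3, h4, h5⟩ := cle_arc γ h
  obtain ⟨τ, hτ, hτe⟩ := arc_coord h1 h2
  refine ⟨fun z => x + (τ z : ℂ) * (y - x), ?_, ?_, ?_⟩
  · rw [h5]
    have : ContinuousOn (fun z => (τ z : ℂ)) (f '' Icc 0 1) :=
      Complex.continuous_ofReal.comp_continuousOn hτ
    fun_prop
  · beta_reduce; rw [← h3, hτe 0 (by simp)]; simp
  · beta_reduce; rw [← h4, hτe 1 (by simp)]; simp

lemma cle_subset {S : H.Subgraph} {e : Sym2 V} (he : e ∈ S.edgeSet) : cle γ e ⊆ γ.image S := by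
  rintro x (hx | ⟨v, hv, rfl⟩)
  · exact Or.inr (mem_biUnion he hx)
  · exact Or.inl ⟨v, S.mem_verts_of_mem_edge he hv, rfl⟩

lemma image_eq (S : H.Subgraph) :
    γ.image S = γ.vmap '' S.verts ∪ ⋃ e ∈ S.edgeSet, cle γ e := by
  apply subset_antisymm
  · apply union_subset_union_right
    exact iUnion₂_mono fun e he => subset_union_left
  · apply union_subset subset_union_left
    exact iUnion₂_subset fun e he => cle_subset γ he

lemma image_mono {S S' : H.Subgraph} (h : S ≤ S') : γ.image S ⊆ γ.image S' := by
  apply union_subset_union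
  · exact Set.image_mono h.1
  · exact biUnion_subset_biUnion_left (SimpleGraph.Subgraph.edgeSet_mono h)

lemma totalImage_eq : γ.totalImage = γ.image ⊤ := by
  simp [Drawing.totalImage, Drawing.image]

lemma image_compact [Finite V] (S : H.Subgraph) : IsCompact (γ.image S) := by
  rw [image_eq]
  apply IsCompact.union
  · exact (Set.toFinite _).isCompact
  · exact (Set.toFinite S.edgeSet).isCompact_biUnion fun e he => cle_compact γ (S.edgeSet_subset he)

variable {γ}

lemma emap_disj (hpl : γ.crossings = ∅) {e e' : Sym2 V} (he : e ∈ H.edgeSet) (he' : e' ∈ H.edgeSet) {x : Plane}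
    (hx : x ∈ γ.emap e) (hx' : x ∈ γ.emap e') : e = e' := by
  by_contra h
  have : x ∈ γ.crossings := ⟨e, he, e', he', h, hx, hx'⟩
  rw [hpl] at this
  exact this

lemma vmap_mem_image {S : H.Subgraph} {v : V} : γ.vmap v ∈ γ.image S ↔ v ∈ S.verts := by
  constructor
  · rintro (⟨w, hw, h⟩ | h)
    · rwa [← γ.vmap_inj h]
    · simp only [mem_iUnion] at h
      obtain ⟨e, he, h⟩ := h
      exact absurd h (γ.avoid e (S.edgeSet_subset he) v)
  · exact fun h => Or.inl ⟨v, h, rfl⟩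

lemma emap_mem_image (hpl : γ.crossings = ∅) {S : H.Subgraph} {e : Sym2 V} (he : e ∈ H.edgeSet) {x : Plane}
    (hx : x ∈ γ.emap e) : x ∈ γ.image S ↔ e ∈ S.edgeSet := by
  constructor
  · rintro (⟨w, hw, rfl⟩ | h)
    · exact absurd hx (γ.avoid e he w)
    · simp only [mem_iUnion] at h
      obtain ⟨e', he', h⟩ := h
      rwa [emap_disj hpl he (S.edgeSet_subset he') hx h]
  · exact fun h => Or.inr (mem_biUnion h hx)

lemma image_inter (hpl : γ.crossings = ∅) (S S' : H.Subgraph) : γ.image S ∩ γ.image S' = γ.image (S ⊓ S') := by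
  apply subset_antisymm
  · rintro x ⟨⟨w, hw, rfl⟩ | h, h'⟩
    · rw [vmap_mem_image] at h' ⊢
      exact ⟨hw, h'⟩
    · simp only [mem_iUnion] at h
      obtain ⟨e, he, h⟩ := h
      rw [emap_mem_image hpl (S.edgeSet_subset he) h] at h' ⊢
      rw [SimpleGraph.Subgraph.edgeSet_inf]
      exact ⟨he, h'⟩
  · exact subset_inter (image_mono γ inf_le_left) (image_mono γ inf_le_right)

/-- Gluing continuous functions along the edges of a subgraph. -/
lemma glue (hpl : γ.crossings = ∅) [Finite V] (S : H.Subgraph) (val : V → ℂ) (g : Sym2 V → Plane → ℂ)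
    (hg : ∀ e ∈ S.edgeSet, ContinuousOn (g e) (cle γ e))
    (hv : ∀ e ∈ S.edgeSet, ∀ v ∈ e, g e (γ.vmap v) = val v) :
    ∃ L : Plane → ℂ, ContinuousOn L (γ.image S) ∧ (∀ v ∈ S.verts, L (γ.vmap v) = val v) ∧
      ∀ e ∈ S.edgeSet, ∀ x ∈ cle γ e, L x = g e x := by
  classical
  let L : Plane → ℂ := fun x => if h : ∃ v, γ.vmap v = x then val h.choose else
    if h : ∃ e ∈ S.edgeSet, x ∈ γ.emap e then g h.choose x else 0
  have hLv : ∀ v, L (γ.vmap v) = val v := by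
    intro v
    have h : ∃ w, γ.vmap w = γ.vmap v := ⟨v, rfl⟩
    simp only [L, h, dif_pos]
    congr 1
    exact γ.vmap_inj h.choose_spec
  have hLe : ∀ e ∈ S.edgeSet, ∀ x ∈ cle γ e, L x = g e x := by
    rintro e he x (hx | ⟨v, hve, rfl⟩)
    · have h1 : ¬ ∃ v, γ.vmap v = x := by
        rintro ⟨v, rfl⟩; exact γ.avoid e (S.edgeSet_subset he) v hx
      have h2 : ∃ e ∈ S.edgeSet, x ∈ γ.emap e := ⟨e, he, hx⟩
      simp only [L, h1, h2, dif_pos, dif_neg, not_false_eq_true]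
      rw [emap_disj hpl (S.edgeSet_subset h2.choose_spec.1) (S.edgeSet_subset he) h2.choose_spec.2 hx]
    · rw [hLv, hv e he v hve]
  refine ⟨L, ?_, fun v _ => hLv v, hLe⟩
  rw [image_eq]
  have hfin : (γ.vmap '' S.verts).Finite := Set.toFinite _
  apply ContinuousOn.union_of_isClosed
  · exact hfin.continuousOn L
  · rw [biUnion_eq_iUnion]
    apply LocallyFinite.continuousOn_iUnion
    · exact locallyFinite_of_finite _
    · exact fun e => (cle_compact γ (S.edgeSet_subset e.2)).isClosed
    · exact fun e => (hg e e.2).congr (hLe e e.2)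
  · exact hfin.isClosed
  · exact (Set.toFinite S.edgeSet).isClosed_biUnion
      fun e he => (cle_compact γ (S.edgeSet_subset he)).isClosed

/-- Gluing functions on edges up to additive constants. -/
lemma log_system (hpl : γ.crossings = ∅) [Finite V] (S : H.Subgraph) (g : Sym2 V → Plane → ℂ)
    (hg : ∀ e ∈ S.edgeSet, ContinuousOn (g e) (cle γ e)) (val : V → ℂ)
    (hval : ∀ u v, S.Adj u v → val v - val u = g s(u, v) (γ.vmap v) - g s(u, v) (γ.vmap u)) :
    ∃ L : Plane → ℂ, ContinuousOn L (γ.image S) ∧ (∀ v ∈ S.verts, L (γ.vmap v) = val v) ∧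
      ∀ e ∈ S.edgeSet, ∀ x ∈ cle γ e, ∀ u ∈ e, L x = g e x + (val u - g e (γ.vmap u)) := by
  have key : ∀ e ∈ S.edgeSet, ∀ u ∈ e, ∀ v ∈ e,
      val u - g e (γ.vmap u) = val v - g e (γ.vmap v) := by
    intro e he u hu v hv
    by_cases huv : u = v
    · rw [huv]
    · have : e = s(u, v) := (Sym2.mem_and_mem_iff huv).1 ⟨hu, hv⟩
      subst this
      have := hval u v he
      linear_combination -this
  obtain ⟨L, h1, h2, h3⟩ := glue hpl S val
    (fun e x => g e x + (val e.out.1 - g e (γ.vmap e.out.1)))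
    (fun e he => (hg e he).add continuousOn_const)
    (fun e he v hv => by
      rw [key e he _ (Sym2.out_fst_mem e) v hv]; ring)
  refine ⟨L, h1, h2, fun e he x hx u hu => ?_⟩
  rw [h3 e he x hx, key e he _ (Sym2.out_fst_mem e) u hu]

lemma image_preconnected (S : H.Subgraph) (hS : S.Connected) : IsPreconnected (γ.image S) := by
  obtain ⟨v0, hv0⟩ := hS.nonempty
  set Q := connectedComponentIn (γ.image S) (γ.vmap v0) with hQ
  have hmem0 : γ.vmap v0 ∈ γ.image S := vmap_mem_image.2 hv0
  have hstep : ∀ e ∈ S.edgeSet, ∀ u ∈ e, γ.vmap u ∈ Q → cle γ e ⊆ Q := by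
    intro e he u hu huQ
    rw [hQ, connectedComponentIn_eq huQ]
    exact (cle_preconnected γ (S.edgeSet_subset he)).subset_connectedComponentIn
      (vmap_mem_cle γ hu) (cle_subset γ he)
  have hall : ∀ v : S.verts, γ.vmap v ∈ Q := by
    intro v
    obtain ⟨w⟩ := hS.preconnected ⟨v0, hv0⟩ v
    have : ∀ (a b : S.verts) (w : S.coe.Walk a b), γ.vmap a ∈ Q → γ.vmap b ∈ Q := by
      intro a b w
      induction w with
      | nil => exact id
      | @cons a b c h p ih =>
        intro ha
        apply ih
        have : S.Adj a b := h
        exact hstep s(a.1, b.1) this a.1 (by simp) ha (vmap_mem_cle γ (by simp))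
    exact this _ _ w (mem_connectedComponentIn hmem0)
  have : γ.image S = Q := by
    apply subset_antisymm _ (connectedComponentIn_subset _ _)
    refine (image_eq γ S).subset.trans ?_
    apply union_subset
    · rintro _ ⟨v, hv, rfl⟩; exact hall ⟨v, hv⟩
    · refine iUnion₂_subset fun e he => ?_
      exact hstep e he e.out.1 (Sym2.out_fst_mem e)
        (hall ⟨_, S.mem_verts_of_mem_edge he (Sym2.out_fst_mem e)⟩)
  rw [this]
  exact isPreconnected_connectedComponentIn

end drawing

section walks
variable {V : Type} {G : SimpleGraph V}

/-- Sum of a function of darts along a walk. -/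
def wsum (d : V → V → ℂ) : ∀ {u v : V}, G.Walk u v → ℂ
  | _, _, .nil => 0
  | _, _, .cons (u := a) (v := b) _ p => d a b + wsum d p

@[simp] lemma wsum_nil (d : V → V → ℂ) (u : V) : wsum d (SimpleGraph.Walk.nil : G.Walk u u) = 0 := rfl

@[simp] lemma wsum_cons (d : V → V → ℂ) {u v w : V} (h : G.Adj u v) (p : G.Walk v w) :
    wsum d (SimpleGraph.Walk.cons h p) = d u v + wsum d p := rfl

lemma wsum_append (d : V → V → ℂ) {u v w : V} (p : G.Walk u v) (q : G.Walk v w) :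
    wsum d (p.append q) = wsum d p + wsum d q := by
  induction p with
  | nil => simp
  | cons h p ih => simp [ih, add_assoc]

lemma wsum_reverse (d : V → V → ℂ) (hd : ∀ a b, d a b = - d b a) {u v : V} (p : G.Walk u v) :
    wsum d p.reverse = - wsum d p := by
  induction p with
  | nil => simp
  | @cons a b c h p ih =>
    rw [SimpleGraph.Walk.reverse_cons, wsum_append, ih]
    simp [hd b a]

lemma wsum_potential (d : V → V → ℂ) (L : V → ℂ) {u v : V} (p : G.Walk u v)
    (h : ∀ a b, s(a, b) ∈ p.edges → d a b = L b - L a) : wsum d p = L v - L u := by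
  induction p with
  | nil => simp
  | @cons a b c hab p ih =>
    rw [wsum_cons, ih (fun x y hxy => h x y (by simp [hxy])), h a b (by simp)]
    ring

lemma wsum_path (d : V → V → ℂ) (hd : ∀ a b, d a b = - d b a)
    (hc : ∀ (u : V) (c : G.Walk u u), c.IsCycle → wsum d c = 0) {u v : V} (p : G.Walk u v) :
    ∃ q : G.Walk u v, q.IsPath ∧ wsum d q = wsum d p := by
  classical
  induction p with
  | nil => exact ⟨.nil, by simp, rfl⟩
  | @cons a b c h p ih =>
    obtain ⟨q, hq, hqs⟩ := ih
    by_cases ha : a ∈ q.support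
    · refine ⟨q.dropUntil a ha, hq.dropUntil ha, ?_⟩
      have hsplit : wsum d q = wsum d (q.takeUntil a ha) + wsum d (q.dropUntil a ha) := by
        rw [← wsum_append, SimpleGraph.Walk.take_spec]
      have hr := hq.takeUntil ha
      have : d a b + wsum d (q.takeUntil a ha) = 0 := by
        generalize q.takeUntil a ha = r at hr
        by_cases he : s(a, b) ∈ r.edges
        · cases r with
          | nil => simp at he
          | @cons _ y _ h' r' =>
            rw [SimpleGraph.Walk.cons_isPath_iff] at hr
            rw [SimpleGraph.Walk.edges_cons, List.mem_cons] at he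
            rcases he with he | he
            · have hy : y = a := by
                rw [Sym2.eq_swap] at he
                exact (Sym2.congr_right.1 he).symm
              subst hy
              rw [SimpleGraph.Walk.isPath_iff_eq_nil.1 hr.1]
              simp [hd y b]
            · exact absurd (SimpleGraph.Walk.snd_mem_support_of_mem_edges _ he) hr.2
        · have := hc a (.cons h r) ((SimpleGraph.Walk.cons_isCycle_iff r h).2 ⟨hr, he⟩)
          simpa using this
      rw [wsum_cons, ← hqs, hsplit]
      linear_combination -this
    · exact ⟨.cons h q, (SimpleGraph.Walk.cons_isPath_iff h q).2 ⟨hq, ha⟩, by simp [hqs]⟩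

lemma wsum_closed (d : V → V → ℂ) (hd : ∀ a b, d a b = - d b a)
    (hc : ∀ (u : V) (c : G.Walk u u), c.IsCycle → wsum d c = 0) {u : V} (p : G.Walk u u) :
    wsum d p = 0 := by
  obtain ⟨q, hq, hqs⟩ := wsum_path d hd hc p
  rw [← hqs, SimpleGraph.Walk.isPath_iff_eq_nil.1 hq, wsum_nil]

lemma exists_potential (d : V → V → ℂ) (hd : ∀ a b, d a b = - d b a)
    (hc : ∀ (u : V) (c : G.Walk u u), c.IsCycle → wsum d c = 0) (E : V → ℂ) (S : Set V)
    (hE : ∀ v ∈ S, E v ≠ 0) (hS : ∀ u v, G.Adj u v → u ∈ S ∧ v ∈ S)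
    (hdE : ∀ u v, G.Adj u v → Complex.exp (d u v) * E u = E v) :
    ∃ val : V → ℂ, (∀ v ∈ S, Complex.exp (val v) = E v) ∧
      ∀ u v, G.Adj u v → val v - val u = d u v := by
  let r : V → V := fun v => (G.connectedComponentMk v).out
  have hr : ∀ v, G.Reachable (r v) v := fun v =>
    SimpleGraph.ConnectedComponent.exact (Quot.out_eq _)
  have hru : ∀ u v, G.Adj u v → r u = r v := by
    intro u v h
    have : G.connectedComponentMk u = G.connectedComponentMk v :=
      SimpleGraph.ConnectedComponent.sound h.reachable
    simp only [r, this]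
  choose w hw using fun v => (⟨(hr v).some, trivial⟩ : ∃ w : G.Walk (r v) v, True)
  have hexp : ∀ (u v : V) (p : G.Walk u v), Complex.exp (wsum d p) * E u = E v := by
    intro u v p
    induction p with
    | nil => simp
    | @cons a b c h p ih =>
      rw [wsum_cons, Complex.exp_add, ← ih, ← hdE a b h]; ring
  have hrS : ∀ v ∈ S, E (r v) ≠ 0 := by
    intro v hv h0
    have := hexp _ _ (w v)
    rw [h0, mul_zero] at this
    exact hE v hv this.symm
  refine ⟨fun v => Complex.log (E (r v)) + wsum d (w v), ?_, ?_⟩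
  · intro v hv
    rw [Complex.exp_add, Complex.exp_log (hrS v hv), mul_comm, hexp]
  · intro u v h
    have e := hru u v h
    have h1 := wsum_closed d hd hc
      (((w u).append (.cons h .nil)).append ((w v).reverse.copy rfl e.symm))
    have h2 : ∀ {a b b' : V} (q : G.Walk a b) (hb : b = b'), wsum d (q.copy rfl hb) = wsum d q := by
      intro a b b' q hb; subst hb; rfl
    rw [wsum_append, wsum_append, h2, wsum_reverse d hd, wsum_cons, wsum_nil] at h1
    simp only [e]
    linear_combination -h1

end walks

section drawing
variable {V : Type} {H : SimpleGraph V} {γ : Drawing H}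

/-- If a plane graph separates `p` from infinity then so does one of its cycles. -/
lemma exists_cycle_around (hpl : γ.crossings = ∅) [Finite V] (S : H.Subgraph) {p : Plane} (hp : p ∈ boundedSide (γ.image S)) :
    ∃ D : H.Subgraph, D ≤ S ∧ IsCycleSubgraph D ∧ p ∈ boundedSide (γ.image D) := by
  by_contra! hcon
  apply not_hasLog (image_compact γ S).isClosed hp
  have hlog : ∀ D : H.Subgraph, D ≤ S → IsCycleSubgraph D → HasLog p (γ.image D) := by
    intro D hD hcy
    apply hasLog_of_unbounded (image_compact γ D)
    intro hb
    exact hcon D hD hcy ⟨fun h => hp.1 (image_mono γ hD h), hb⟩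
  have hedge : ∀ e ∈ S.edgeSet, HasLog p (cle γ e) := fun e he =>
    cle_hasLog γ (S.edgeSet_subset he) (fun h => hp.1 (cle_subset γ he h))
  choose! g hgc hge using hedge
  let d : V → V → ℂ := fun u v => g s(u, v) (γ.vmap v) - g s(u, v) (γ.vmap u)
  have hd : ∀ a b, d a b = - d b a := by
    intro a b
    simp only [d, Sym2.eq_swap (a := b) (b := a)]
    ring
  have hle : S.spanningCoe ≤ H := S.spanningCoe_le
  obtain ⟨val, hval, hval2⟩ := exists_potential (G := S.spanningCoe) d hd (by
      intro u c hc
      have hc' := (SimpleGraph.Walk.isCycle_mapLe hle).2 hc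
      have hedges : ∀ e, e ∈ (c.mapLe hle).toSubgraph.edgeSet ↔ e ∈ c.edges := by
        intro e
        rw [SimpleGraph.Walk.mem_edges_toSubgraph, SimpleGraph.Walk.edges_mapLe_eq_edges]
      have hcS : ∀ e ∈ c.edges, e ∈ S.edgeSet := by
        intro e he
        have := c.edges_subset_edgeSet he
        simpa using this
      have hDS : (c.mapLe hle).toSubgraph ≤ S := by
        constructor
        · intro v hv
          obtain ⟨w, hw⟩ : ((c.mapLe hle).toSubgraph.neighborSet v).Nonempty := by
            apply Set.nonempty_of_ncard_ne_zero
            rw [hc'.ncard_neighborSet_toSubgraph_eq_two (by simpa using hv)]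
            norm_num
          have := hcS s(v, w) ((hedges _).1 hw)
          exact S.edge_vert this
        · intro a b hab
          exact hcS s(a, b) ((hedges _).1 hab)
      obtain ⟨L, hL, hLe⟩ := hlog _ hDS ⟨SimpleGraph.Walk.toSubgraph_connected _, Set.toFinite _,
        fun v hv => hc'.ncard_neighborSet_toSubgraph_eq_two (by simpa using hv)⟩
      rw [wsum_potential d (fun v => L (γ.vmap v)) c, sub_self]
      intro a b hab
      have hab' := (hedges _).2 hab
      have hsub := cle_subset γ hab'
      have habS := hcS _ hab
      have := exp_eq_const (cle_preconnected γ (S.edgeSet_subset habS)) (hgc _ habS) (hL.mono hsub)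
        (fun x hx => by rw [hge _ habS x hx, hLe x (hsub hx)])
        (vmap_mem_cle γ (show b ∈ s(a, b) by simp)) (vmap_mem_cle γ (show a ∈ s(a, b) by simp))
      simp only [d]
      linear_combination this)
    (fun v => zc (γ.vmap v) - zc p) S.verts (by
      intro v hv
      apply zc_ne
      rintro rfl
      exact hp.1 (vmap_mem_image.2 hv))
    (by
      intro u v h
      have h' : S.Adj u v := by simpa using h
      exact ⟨S.edge_vert h', S.edge_vert h'.symm⟩)
    (by
      intro u v h
      have h' : s(u, v) ∈ S.edgeSet := by simpa using h
      have hu := hge _ h' _ (vmap_mem_cle γ (show u ∈ s(u, v) by simp))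
      have hv := hge _ h' _ (vmap_mem_cle γ (show v ∈ s(u, v) by simp))
      simp only [d]
      rw [← hu, ← Complex.exp_add, ← hv]
      congr 1; ring)
  obtain ⟨L, hL, hLv, hLe⟩ := log_system hpl S g hgc val (fun u v h => hval2 u v (by simpa using h))
  refine ⟨L, hL, ?_⟩
  intro x hx
  rw [image_eq] at hx
  rcases hx with ⟨v, hv, rfl⟩ | hx
  · rw [hLv v hv, hval v hv]
  · simp only [mem_iUnion] at hx
    obtain ⟨e, he, hx⟩ := hx
    have hu := Sym2.out_fst_mem e
    rw [hLe e he x hx _ hu, Complex.exp_add, Complex.exp_sub, hge e he x hx,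
      hval _ (S.mem_verts_of_mem_edge he hu), hge e he _ (vmap_mem_cle γ hu), div_self, mul_one]
    rw [← hge e he _ (vmap_mem_cle γ hu)]
    exact Complex.exp_ne_zero _

end drawing

section faces
variable {V : Type} {H : SimpleGraph V} {γ : Drawing H}

lemma totalImage_closed [Finite V] (γ : Drawing H) : IsClosed γ.totalImage := by
  rw [totalImage_eq]; exact (image_compact γ _).isClosed

lemma face_open [Finite V] {F : Set Plane} (hF : F ∈ γ.faces) : IsOpen F := by
  obtain ⟨x, hx, rfl⟩ := hF
  exact (totalImage_closed γ).isOpen_compl.connectedComponentIn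

lemma face_sub {F : Set Plane} (hF : F ∈ γ.faces) {y : Plane} (hy : y ∈ F) : y ∉ γ.image ⊤ := by
  obtain ⟨x, hx, rfl⟩ := hF
  rw [← totalImage_eq]
  exact connectedComponentIn_subset _ _ hy

lemma face_pre {F : Set Plane} (hF : F ∈ γ.faces) : IsPreconnected F := by
  obtain ⟨x, hx, rfl⟩ := hF
  exact isPreconnected_connectedComponentIn

lemma face_unique {F F' : Set Plane} (hF : F ∈ γ.faces) (hF' : F' ∈ γ.faces) {y : Plane}
    (hy : y ∈ F) (hy' : y ∈ F') : F = F' := by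
  obtain ⟨x, hx, rfl⟩ := hF
  obtain ⟨x', hx', rfl⟩ := hF'
  rw [connectedComponentIn_eq hy, connectedComponentIn_eq hy']

lemma face_nonempty {F : Set Plane} (hF : F ∈ γ.faces) : F.Nonempty := by
  obtain ⟨x, hx, rfl⟩ := hF
  exact ⟨x, mem_connectedComponentIn hx⟩

lemma exists_face {x : Plane} (hx : x ∉ γ.image ⊤) : ∃ F ∈ γ.faces, x ∈ F := by
  rw [← totalImage_eq] at hx
  exact ⟨_, ⟨x, hx, rfl⟩, mem_connectedComponentIn hx⟩

/-- The properties of the outer face. -/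
structure IsOuter (γ : Drawing H) (O : Set Plane) : Prop where
  face : O ∈ γ.faces
  compl_bdd : IsBounded Oᶜ
  bdd : ∀ F ∈ γ.faces, F ≠ O → IsBounded F

lemma IsOuter.unbdd {O : Set Plane} (h : IsOuter γ O) : ¬ IsBounded O := by
  intro hb
  have := hb.union h.compl_bdd
  rw [union_compl_self] at this
  exact NormedSpace.unbounded_univ ℝ Plane this

lemma exists_outer [Finite V] (γ : Drawing H) : ∃ O, IsOuter γ O := by
  have hc := image_compact γ ⊤
  obtain ⟨R, hR⟩ := hc.isBounded.exists_norm_le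
  have hfar : {x : Plane | R < ‖x‖} ⊆ γ.totalImageᶜ := by
    intro x hx hx'
    rw [totalImage_eq] at hx'
    exact absurd (hR x hx') (not_le.2 hx)
  obtain ⟨x0, hx0⟩ : ∃ x0 : Plane, R < ‖x0‖ := NormedSpace.exists_lt_norm ℝ Plane R
  have hsub : {x : Plane | R < ‖x‖} ⊆ connectedComponentIn γ.totalImageᶜ x0 :=
    (far_preconnected R).subset_connectedComponentIn hx0 hfar
  have hb : IsBounded (connectedComponentIn γ.totalImageᶜ x0)ᶜ := by
    apply (Metric.isBounded_closedBall (x := (0:Plane)) (r := R)).subset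
    intro x hx
    rw [mem_closedBall_zero_iff]
    by_contra h
    exact hx (hsub (not_le.1 h))
  have hO : connectedComponentIn γ.totalImageᶜ x0 ∈ γ.faces := ⟨x0, hfar hx0, rfl⟩
  refine ⟨_, hO, hb, ?_⟩
  intro F hF hne
  apply hb.subset
  intro y hy hy'
  exact hne (face_unique hF hO hy hy')

lemma image_disjoint (hpl : γ.crossings = ∅) {S S' : H.Subgraph} (h : Disjoint S.verts S'.verts) :
    Disjoint (γ.image S) (γ.image S') := by
  rw [disjoint_iff_inter_eq_empty, image_inter hpl, eq_empty_iff_forall_notMem]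
  have hv : (S ⊓ S').verts = ∅ := h.inter_eq
  rintro x (⟨v, hv', _⟩ | hx)
  · rw [hv] at hv'; exact hv'
  · simp only [mem_iUnion] at hx
    obtain ⟨e, he, _⟩ := hx
    have := (S ⊓ S').mem_verts_of_mem_edge he (Sym2.out_fst_mem e)
    rw [hv] at this; exact this

lemma triangle_adj {T : H.Subgraph} (hT : IsCycleSubgraph T) (h3 : T.verts.ncard = 3) {u v : V}
    (hu : u ∈ T.verts) (hv : v ∈ T.verts) (huv : u ≠ v) : T.Adj u v := by
  have hsub : T.neighborSet u ⊆ T.verts \ {u} := by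
    intro w hw
    exact ⟨T.edge_vert hw.symm, fun h => T.loopless.irrefl u (by rw [mem_singleton_iff] at h; rwa [h] at hw)⟩
  have hfin : (T.verts \ {u}).Finite := hT.2.1.subset sdiff_subset
  have : T.neighborSet u = T.verts \ {u} := by
    apply eq_of_subset_of_ncard_le hsub _ hfin
    rw [hT.2.2 u hu, ncard_sdiff_singleton_of_mem hu, h3]
  have hv' : v ∈ T.verts \ {u} := ⟨hv, fun h => huv h.symm⟩
  rw [← this] at hv'
  exact hv'

/-- Level structure. -/
structure IsLevel (C : H.Subgraph) (lev : V → ℕ) : Prop where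
  zero : ∀ v, lev v = 0 ↔ v ∈ C.verts
  adj : ∀ u v, H.Adj u v → lev u ≤ lev v + 1
  pred : ∀ v j, lev v = j + 1 → ∃ u, H.Adj u v ∧ lev u = j

/-- Subgraph induced by a set of levels. -/
def levSub (H : SimpleGraph V) (lev : V → ℕ) (I : Set ℕ) : H.Subgraph :=
  (⊤ : H.Subgraph).induce {v | lev v ∈ I}

lemma le_levSub {lev : V → ℕ} {I : Set ℕ} {S : H.Subgraph} (h : ∀ v ∈ S.verts, lev v ∈ I) :
    S ≤ levSub H lev I := by
  constructor
  · exact fun v hv => h v hv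
  · intro u v huv
    exact ⟨h _ (S.edge_vert huv), h _ (S.edge_vert huv.symm), S.adj_sub huv⟩

lemma levSub_verts {lev : V → ℕ} {I : Set ℕ} (v : V) : v ∈ (levSub H lev I).verts ↔ lev v ∈ I := Iff.rfl

lemma lemmaA [Finite V] (hpl : γ.crossings = ∅) {C : H.Subgraph} {lev : V → ℕ}
    (hlev : IsLevel C lev) {O : Set Plane} (hO : IsOuter γ O) (hOC : frontier O = γ.image C)
    (hneartri : ∀ F ∈ γ.faces, IsBounded F →
      ∃ T : H.Subgraph, IsCycleSubgraph T ∧ T.verts.ncard = 3 ∧ frontier F = γ.image T)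
    {i : ℕ} {v : V} (hv : i < lev v) : γ.vmap v ∈ boundedSide (γ.image (levSub H lev {i})) := by
  set lo := levSub H lev (Iic i) with hlo
  set hi := levSub H lev (Ici i) with hhi
  set S := levSub H lev {i} with hS
  have hvS : γ.vmap v ∉ γ.image S := by
    rw [vmap_mem_image, hS, levSub_verts]
    simp; omega
  refine ⟨hvS, ?_⟩
  have hinf : lo ⊓ hi ≤ S := by
    apply le_levSub
    rintro w ⟨h1, h2⟩
    exact le_antisymm h1 h2
  have hB : ∀ F ∈ γ.faces, ¬ frontier F ⊆ γ.image lo → F ≠ O ∧ frontier F ⊆ γ.image hi := by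
    intro F hF hn
    have hFO : F ≠ O := by
      rintro rfl
      apply hn
      rw [hOC]
      apply image_mono
      apply le_levSub
      intro w hw
      rw [(hlev.zero w).2 hw]; simp
    refine ⟨hFO, ?_⟩
    obtain ⟨T, hT, hT3, hFT⟩ := hneartri F hF (hO.bdd F hF hFO)
    rw [hFT] at hn ⊢
    obtain ⟨w, hw, hwi⟩ : ∃ w ∈ T.verts, i < lev w := by
      by_contra! hc
      exact hn (image_mono γ (le_levSub hc))
    apply image_mono
    apply le_levSub
    intro x hx
    show i ≤ lev x
    by_cases hxw : w = x
    · rw [← hxw]; omega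
    · have := hlev.adj w x (T.adj_sub (triangle_adj hT hT3 hw hx hxw))
      omega
  set A := ⋃₀ {F | F ∈ γ.faces ∧ frontier F ⊆ γ.image lo} ∪ γ.image lo with hA
  set B := ⋃₀ {F | F ∈ γ.faces ∧ ¬ frontier F ⊆ γ.image lo} ∪ γ.image hi with hB'
  have hAc : IsClosed A := closure_sUnion_comp (image_compact γ lo).isClosed fun F hF => hF.2
  have hBc : IsClosed B := closure_sUnion_comp (image_compact γ hi).isClosed
    fun F hF => (hB F hF.1 hF.2).2
  have htop : ∀ S' : H.Subgraph, γ.image S' ⊆ γ.image ⊤ := fun S' => image_mono γ le_top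
  have hAB : A ∩ B ⊆ γ.image S := by
    rintro x ⟨⟨F, ⟨hF, hFl⟩, hxF⟩ | hx, ⟨F', ⟨hF', hFl'⟩, hxF'⟩ | hx'⟩
    · exact absurd (face_unique hF hF' hxF hxF' ▸ hFl) hFl'
    · exact absurd (htop _ hx') (face_sub hF hxF)
    · exact absurd (htop _ hx) (face_sub hF' hxF')
    · apply image_mono γ hinf
      rw [← image_inter hpl]; exact ⟨hx, hx'⟩
  have hcov : ∀ x, x ∈ A ∪ B := by
    intro x
    by_cases hx : x ∈ γ.image ⊤
    · rcases hx with ⟨w, _, rfl⟩ | hx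
      · rcases le_total (lev w) i with h | h
        · exact Or.inl (Or.inr (vmap_mem_image.2 h))
        · exact Or.inr (Or.inr (vmap_mem_image.2 h))
      · simp only [mem_iUnion] at hx
        obtain ⟨e, he, hx⟩ := hx
        induction e with
        | h a b =>
          have hab : H.Adj a b := he
          have h1 := hlev.adj a b hab
          have h2 := hlev.adj b a hab.symm
          by_cases h : lev a ≤ i ∧ lev b ≤ i
          · refine Or.inl (Or.inr ((emap_mem_image hpl he hx).2 ?_))
            exact ⟨h.1, h.2, hab⟩
          · refine Or.inr (Or.inr ((emap_mem_image hpl he hx).2 ?_))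
            exact ⟨show i ≤ lev a by omega, show i ≤ lev b by omega, hab⟩
    · obtain ⟨F, hF, hxF⟩ := exists_face hx
      by_cases h : frontier F ⊆ γ.image lo
      · exact Or.inl (Or.inl ⟨F, ⟨hF, h⟩, hxF⟩)
      · exact Or.inr (Or.inl ⟨F, ⟨hF, h⟩, hxF⟩)
  have hBO : B ⊆ Oᶜ := by
    rintro x (⟨F, ⟨hF, hFl⟩, hxF⟩ | hx) hxO
    · exact (hB F hF hFl).1 (face_unique hF hO.face hxF hxO)
    · exact face_sub hO.face hxO (htop _ hx)
  have hpre : IsPreconnected (connectedComponentIn (γ.image S)ᶜ (γ.vmap v)) :=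
    isPreconnected_connectedComponentIn
  have hmem := mem_connectedComponentIn (F := (γ.image S)ᶜ) hvS
  apply hO.compl_bdd.subset
  refine subset_trans ?_ hBO
  intro x hx
  by_contra hxB
  have hxA : x ∈ A := (hcov x).resolve_right hxB
  obtain ⟨y, hy, hyAB⟩ := isPreconnected_closed_iff.1 hpre A B hAc hBc (fun y _ => hcov y) ⟨x, hx, hxA⟩
    ⟨_, hmem, Or.inr (vmap_mem_image.2 (le_of_lt hv))⟩
  exact connectedComponentIn_subset _ _ hy (hAB hyAB)

lemma nesting [Finite V] (hpl : γ.crossings = ∅) {C : H.Subgraph} {lev : V → ℕ}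
    (hlev : IsLevel C lev) {O : Set Plane} (hO : IsOuter γ O) (hOC : frontier O = γ.image C)
    {i : ℕ} {D D' : H.Subgraph} (hD' : D' ≤ levSub H lev {i}) (hD : D ≤ levSub H lev {i + 1})
    (hDc : D.Connected) (hDc' : D'.Connected) {p : Plane} (hp : p ∈ boundedSide (γ.image D))
    (hp' : p ∈ boundedSide (γ.image D')) : γ.image D ⊆ closedRegion (γ.image D') := by
  have hlD : ∀ v ∈ D.verts, lev v = i + 1 := fun v hv => hD.1 hv
  have hlD' : ∀ v ∈ D'.verts, lev v = i := fun v hv => hD'.1 hv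
  have hdis : Disjoint (γ.image D) (γ.image D') := by
    apply image_disjoint hpl
    rw [Set.disjoint_left]
    intro v h1 h2
    have := hlD v h1
    have := hlD' v h2
    omega
  have htop : ∀ S' : H.Subgraph, γ.image S' ⊆ γ.image ⊤ := fun S' => image_mono γ le_top
  obtain ⟨x0, hx0⟩ := face_nonempty hO.face
  have hOD : O ⊆ (γ.image D)ᶜ := fun x hx hx' => face_sub hO.face hx (htop _ hx')
  set W := connectedComponentIn (γ.image D)ᶜ x0 with hW
  have hOW : O ⊆ W := (face_pre hO.face).subset_connectedComponentIn hx0 hOD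
  have hvW : ∀ j, j ≤ i → ∀ v, lev v = j → γ.vmap v ∈ W := by
    intro j
    induction j with
    | zero =>
      intro _ v hv
      have hvO : γ.vmap v ∈ closure O := by
        apply frontier_subset_closure
        rw [hOC, vmap_mem_image]
        exact (hlev.zero v).1 hv
      have hpre : IsPreconnected (insert (γ.vmap v) O) :=
        (face_pre hO.face).subset_closure (subset_insert _ _)
          (insert_subset hvO subset_closure)
      apply hpre.subset_connectedComponentIn (mem_insert_of_mem _ hx0) _ (mem_insert _ _)
      apply insert_subset _ hOD
      intro h
      have := hlD v (vmap_mem_image.1 h)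
      omega
    | succ j ih =>
      intro hj v hv
      obtain ⟨u, huv, hu⟩ := hlev.pred v j hv
      have huW := ih (by omega) u hu
      rw [hW, connectedComponentIn_eq huW]
      apply (cle_preconnected γ (show s(u, v) ∈ H.edgeSet from huv)).subset_connectedComponentIn
        (vmap_mem_cle γ (by simp)) _ (vmap_mem_cle γ (by simp))
      intro x hx hxD
      have hxlo : x ∈ γ.image (levSub H lev (Iic i)) := by
        apply cle_subset γ _ hx
        exact ⟨show lev u ≤ i by omega, show lev v ≤ i by omega, huv⟩
      have hd : Disjoint (γ.image D) (γ.image (levSub H lev (Iic i))) := by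
        apply image_disjoint hpl
        rw [Set.disjoint_left]
        intro w h1 h2
        have := hlD w h1
        have : lev w ≤ i := h2
        omega
      exact Set.disjoint_left.1 hd hxD hxlo
  obtain ⟨w0, hw0⟩ := hDc'.nonempty
  have hw0W := hvW i le_rfl w0 (hlD' w0 hw0)
  have hD'W : γ.image D' ⊆ W := by
    rw [hW, connectedComponentIn_eq hw0W]
    exact (image_preconnected D' hDc').subset_connectedComponentIn (vmap_mem_image.2 hw0)
      fun x hx hx' => Set.disjoint_left.1 hdis hx' hx
  set B := connectedComponentIn (γ.image D)ᶜ p with hB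
  have hBW : ∀ x ∈ B, x ∉ W := by
    intro x hx hx'
    have : B = W := by rw [hB, connectedComponentIn_eq hx, hW, connectedComponentIn_eq hx']
    rw [← this] at hOW
    exact hO.unbdd (hp.2.subset hOW)
  have hpB : p ∈ B := mem_connectedComponentIn hp.1
  set A := connectedComponentIn (γ.image D')ᶜ p with hA
  have hBA : B ⊆ A := isPreconnected_connectedComponentIn.subset_connectedComponentIn hpB
    fun x hx hx' => hBW x hx (hD'W hx')
  have hBo : IsOpen B := (image_compact γ D).isClosed.isOpen_compl.connectedComponentIn
  obtain ⟨z, hz⟩ : (frontier B).Nonempty := by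
    rw [nonempty_frontier_iff]
    refine ⟨⟨p, hpB⟩, fun h => ?_⟩
    have hb := hp.2
    rw [← hB, h] at hb
    exact NormedSpace.unbounded_univ ℝ Plane hb
  have hzD : z ∈ γ.image D := by
    rcases closure_comp_subset hz.1 with h | h
    · rw [hBo.frontier_eq] at hz
      exact absurd h hz.2
    · exact h
  have hzA : z ∈ A := by
    rcases closure_comp_subset (closure_mono hBA hz.1) with h | h
    · exact h
    · exact absurd h (Set.disjoint_left.1 hdis hzD)
  intro x hx
  refine Or.inr ⟨Set.disjoint_left.1 hdis hx, ?_⟩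
  have hxA : x ∈ A := by
    rw [hA, connectedComponentIn_eq hzA]
    exact (image_preconnected D hDc).subset_connectedComponentIn hzD
      (fun x hx hx' => Set.disjoint_left.1 hdis hx hx') hx
  rw [← connectedComponentIn_eq hxA]
  exact hp'.2

lemma main_of_deep [Finite V] (hpl : γ.crossings = ∅) {C : H.Subgraph} {lev : V → ℕ}
    (hlev : IsLevel C lev) {O : Set Plane} (hO : IsOuter γ O) (hOC : frontier O = γ.image C)
    (hneartri : ∀ F ∈ γ.faces, IsBounded F →
      ∃ T : H.Subgraph, IsCycleSubgraph T ∧ T.verts.ncard = 3 ∧ frontier F = γ.image T)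
    (k : ℕ) (v : V) (hv : k ≤ lev v) :
    ∃ D : Fin k → H.Subgraph,
      (∀ i, IsCycleSubgraph (D i)) ∧
      (∀ i j, i ≠ j → Disjoint (D i).verts (D j).verts) ∧
      (∀ i : ℕ, ∀ h : i + 1 < k,
        γ.image (D ⟨i + 1, h⟩) ⊆ closedRegion (γ.image (D ⟨i, by omega⟩))) := by
  have h := fun i : Fin k => exists_cycle_around hpl (levSub H lev {i.1})
    (lemmaA hpl hlev hO hOC hneartri (i := i.1) (v := v) (by omega))
  choose D hD1 hD2 hD3 using h
  refine ⟨D, hD2, ?_, ?_⟩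
  · intro i j hij
    rw [Set.disjoint_left]
    intro w hi hj
    have h1 : lev w = i.1 := (hD1 i).1 hi
    have h2 : lev w = j.1 := (hD1 j).1 hj
    exact hij (Fin.ext (h1.symm.trans h2))
  · intro i h
    exact nesting hpl hlev hO hOC (hD1 ⟨i, by omega⟩) (hD1 ⟨i + 1, h⟩) (hD2 _).1 (hD2 _).1 (hD3 _) (hD3 _)

end faces

section param
variable {V : Type} {H : SimpleGraph V}

/-- A periodic parametrization of a cycle of length `n`. -/
structure IsParam (C : H.Subgraph) (n : ℕ) (c : ℤ → V) : Prop where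
  adj : ∀ i, C.Adj (c i) (c (i + 1))
  surj : ∀ v ∈ C.verts, ∃ i, c i = v
  eq_iff : ∀ i j, c i = c j ↔ (n : ℤ) ∣ j - i
  nbr : ∀ i w, C.Adj (c i) w → w = c (i + 1) ∨ w = c (i - 1)

lemma exists_param [Finite V] {C : H.Subgraph} (hC : IsCycleSubgraph C) :
    ∃ c, IsParam C C.verts.ncard c := by
  obtain ⟨v0, hv0⟩ := hC.1.nonempty
  have hnb : ∀ v, C.spanningCoe.neighborSet v = C.neighborSet v := by
    intro v; ext w; simp
  have hcyc : C.spanningCoe.IsCycles := by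
    intro v hv
    rw [hnb] at hv ⊢
    obtain ⟨w, hw⟩ := hv
    exact hC.2.2 v (C.edge_vert hw)
  have hne : (C.spanningCoe.neighborSet v0).Nonempty := by
    rw [hnb]
    apply Set.nonempty_of_ncard_ne_zero
    rw [hC.2.2 v0 hv0]; norm_num
  obtain ⟨p, hp, hpv⟩ := hcyc.exists_cycle_toSubgraph_verts_eq_connectedComponentSupp
    (c := C.spanningCoe.connectedComponentMk v0) (v := v0) rfl hne
  have hadjp : ∀ i < p.length, C.Adj (p.getVert i) (p.getVert (i + 1)) := by
    intro i hi
    simpa using p.adj_getVert_succ hi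
  have hlen := hp.three_le_length
  have hsup : ∀ v, v ∈ C.verts ↔ ∃ i < p.length, p.getVert i = v := by
    intro v
    constructor
    · intro hv
      have : v ∈ p.toSubgraph.verts := by
        rw [hpv]
        obtain ⟨w⟩ := hC.1.preconnected ⟨v, hv⟩ ⟨v0, hv0⟩
        exact SimpleGraph.ConnectedComponent.sound ((w.map C.coeEmbeddingSpanningCoe.toHom).reachable)
      rw [SimpleGraph.Walk.mem_verts_toSubgraph, SimpleGraph.Walk.mem_support_iff_exists_getVert] at this
      obtain ⟨i, hi, hil⟩ := this
      rcases hil.lt_or_eq with h | h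
      · exact ⟨i, h, hi⟩
      · refine ⟨0, by omega, ?_⟩
        rw [← hi, h]; simp
    · rintro ⟨i, hi, rfl⟩
      exact C.edge_vert (hadjp i hi)
  have hinj : ∀ i < p.length, ∀ j < p.length, p.getVert i = p.getVert j → i = j := by
    intro i hi j hj h
    exact hp.getVert_injOn' (by show i ≤ p.length - 1; omega) (by show j ≤ p.length - 1; omega) h
  have hn : C.verts.ncard = p.length := by
    have : C.verts = p.getVert '' (Iio p.length) := by
      ext v; rw [hsup]; simp
    have hI : InjOn p.getVert (Iio p.length) := fun i hi j hj h => hinj i hi j hj h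
    rw [this, hI.ncard_image]
    rw [← Finset.coe_Iio, ncard_coe_finset]; simp
  rw [hn]
  set n := p.length with hn'
  have hn0 : (0:ℤ) < n := by omega
  let c : ℤ → V := fun i => p.getVert (i % n).toNat
  have hm : ∀ i : ℤ, (i % n).toNat < n ∧ ((i % n).toNat : ℤ) = i % n := by
    intro i
    have h1 := Int.emod_nonneg i hn0.ne'
    have h2 := Int.emod_lt_of_pos i hn0
    omega
  have hsucc : ∀ i : ℤ, c (i + 1) = p.getVert ((i % n).toNat + 1) := by
    intro i
    obtain ⟨h1, h2⟩ := hm i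
    obtain ⟨h3, h4⟩ := hm (i + 1)
    simp only [c]
    by_cases h : (i % n).toNat + 1 < n
    · congr 1
      have : (i + 1) % n = i % n + 1 := by
        rw [Int.add_emod, Int.emod_eq_of_lt (a := 1) (by norm_num) (by omega)]
        exact Int.emod_eq_of_lt (by omega) (by omega)
      omega
    · have h5 : (i % n).toNat + 1 = n := by omega
      have : (i + 1) % n = 0 := by
        rw [Int.add_emod, Int.emod_eq_of_lt (a := 1) (by norm_num) (by omega)]
        have : i % n + 1 = n := by omega
        rw [this]; simp
      rw [this, h5, hn']; simp
  have hadj : ∀ i, C.Adj (c i) (c (i + 1)) := by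
    intro i
    rw [hsucc]
    exact hadjp _ (hm i).1
  have heq : ∀ i j, c i = c j ↔ (n : ℤ) ∣ j - i := by
    intro i j
    constructor
    · intro h
      have := hinj _ (hm i).1 _ (hm j).1 h
      apply Int.ModEq.dvd
      show i % n = j % n
      rw [← (hm i).2, ← (hm j).2, this]
    · intro h
      have : i % n = j % n := (Int.modEq_iff_dvd.2 h)
      simp only [c, this]
  refine ⟨c, hadj, ?_, heq, ?_⟩
  · intro v hv
    obtain ⟨i, hi, rfl⟩ := (hsup v).1 hv
    refine ⟨i, ?_⟩
    simp only [c]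
    congr 1
    rw [Int.emod_eq_of_lt (by omega) (by omega)]; simp
  · intro i w hw
    have h1 : C.Adj (c i) (c (i - 1)) := by
      have := hadj (i - 1)
      rw [sub_add_cancel] at this
      exact this.symm
    have hne : c (i + 1) ≠ c (i - 1) := by
      rw [Ne, heq]
      intro h
      have := Int.le_of_dvd (by norm_num) (show (n:ℤ) ∣ 2 by
        obtain ⟨t, ht⟩ := h
        exact ⟨-t, by linarith⟩)
      omega
    have : ({c (i + 1), c (i - 1)} : Set V) = C.neighborSet (c i) := by
      apply eq_of_subset_of_ncard_le _ _ (Set.toFinite _)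
      · rintro x (rfl | rfl)
        · exact hadj i
        · exact h1
      · rw [hC.2.2 _ (C.edge_vert (hadj i)), ncard_pair hne]
    have hw' : w ∈ C.neighborSet (c i) := hw
    rw [← this] at hw'
    exact hw'

lemma IsParam.mem {C : H.Subgraph} {n : ℕ} {c : ℤ → V} (h : IsParam C n c) (i : ℤ) : c i ∈ C.verts :=
  C.edge_vert (h.adj i)

lemma IsParam.lift {C : H.Subgraph} {n : ℕ} {c : ℤ → V} (h : IsParam C n c) {u v : C.verts}
    (w : C.coe.Walk u v) (i : ℤ) (hi : c i = u) : ∃ j, c j = v ∧ |j - i| ≤ w.length := by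
  induction w generalizing i with
  | nil => exact ⟨i, hi, by simp⟩
  | @cons a b d hab p ih =>
    have hab' : C.Adj (c i) b := by rw [hi]; exact hab
    have : ∃ i', c i' = b ∧ |i' - i| ≤ 1 := by
      rcases h.nbr i b hab' with h1 | h1
      · exact ⟨i + 1, h1.symm, by simp⟩
      · exact ⟨i - 1, h1.symm, by simp⟩
    obtain ⟨i', hi', h1⟩ := this
    obtain ⟨j, hj, h2⟩ := ih i' hi'
    refine ⟨j, hj, ?_⟩
    have := abs_sub_le j i' i
    rw [SimpleGraph.Walk.length_cons]; push_cast; linarith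

lemma IsParam.edge {C : H.Subgraph} {n : ℕ} {c : ℤ → V} (h : IsParam C n c) {e : Sym2 V}
    (he : e ∈ C.edgeSet) : ∃ i, e = s(c i, c (i + 1)) := by
  induction e with
  | h a b =>
    have hab : C.Adj a b := he
    obtain ⟨i, rfl⟩ := h.surj a (C.edge_vert hab)
    rcases h.nbr i b hab with rfl | rfl
    · exact ⟨i, rfl⟩
    · refine ⟨i - 1, ?_⟩
      rw [sub_add_cancel, Sym2.eq_swap]

lemma IsParam.periodic {C : H.Subgraph} {n : ℕ} {c : ℤ → V} (h : IsParam C n c) (i t : ℤ) :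
    c (i + n * t) = c i := by
  rw [h.eq_iff]; exact ⟨-t, by ring⟩

end param

section jordan
variable {V : Type} {H : SimpleGraph V} {γ : Drawing H}

lemma cle_path_log {u v : V} (h : H.Adj u v) : ∃ g : Plane → ℂ, ContinuousOn g (cle γ s(u, v))ᶜ ∧
    ∀ x ∉ cle γ s(u, v), Complex.exp (g x) = (zc x - zc (γ.vmap v)) / (zc x - zc (γ.vmap u)) := by
  obtain ⟨f, h1, h2, h3, h4, h5⟩ := cle_arc γ h
  rw [h5, ← h3, ← h4]
  exact path_log h1

lemma cle_inter (hpl : γ.crossings = ∅) {e e' : Sym2 V} (he : e ∈ H.edgeSet) (he' : e' ∈ H.edgeSet)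
    (hne : e ≠ e') {x : Plane} (hx : x ∈ cle γ e) (hx' : x ∈ cle γ e') :
    ∃ v ∈ e, v ∈ e' ∧ x = γ.vmap v := by
  rcases hx with hx | ⟨v, hv, rfl⟩
  · rcases hx' with hx' | ⟨v, hv, rfl⟩
    · exact absurd (emap_disj hpl he he' hx hx') hne
    · exact absurd hx (γ.avoid e he v)
  · rcases hx' with hx' | ⟨w, hw, h⟩
    · exact absurd hx' (γ.avoid e' he' v)
    · exact ⟨v, hv, by rwa [← γ.vmap_inj h], rfl⟩

lemma jordan [Finite V] (hpl : γ.crossings = ∅) {C : H.Subgraph} {n : ℕ} (hn : 3 ≤ n) {c : ℤ → V}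
    (hc : IsParam C n c) (hne : ((γ.image C)ᶜ).Nonempty) : ¬ IsPreconnected (γ.image C)ᶜ := by
  have hadj : ∀ i, H.Adj (c i) (c (i + 1)) := fun i => C.adj_sub (hc.adj i)
  let ed : ℤ → Sym2 V := fun i => s(c i, c (i + 1))
  have hed : ∀ i, ed i ∈ H.edgeSet := fun i => hadj i
  let Y : ℕ → Set Plane := fun m => ⋃ i : Fin m, cle γ (ed (i.1 + 1))
  have hYs : ∀ m, Y (m + 1) = Y m ∪ cle γ (ed (m + 1)) := by
    intro m
    ext x
    simp only [Y, mem_iUnion, mem_union]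
    constructor
    · rintro ⟨i, hi⟩
      rcases Nat.lt_succ_iff_lt_or_eq.1 i.2 with h | h
      · exact Or.inl ⟨⟨i.1, h⟩, hi⟩
      · right; rwa [h] at hi
    · rintro (⟨i, hi⟩ | hx)
      · exact ⟨⟨i.1, by omega⟩, hi⟩
      · exact ⟨⟨m, by omega⟩, hx⟩
  have hYmem : ∀ m i : ℕ, i < m → cle γ (ed ((i : ℤ) + 1)) ⊆ Y m := by
    intro m i hi x hx
    exact mem_iUnion.2 ⟨⟨i, hi⟩, hx⟩
  have hlog : ∀ m, ∃ g : Plane → ℂ, ContinuousOn g (Y (m + 1))ᶜ ∧ ∀ x ∉ Y (m + 1),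
      Complex.exp (g x) = (zc x - zc (γ.vmap (c (m + 2)))) / (zc x - zc (γ.vmap (c 1))) := by
    intro m
    induction m with
    | zero =>
      obtain ⟨g, h1, h2⟩ := cle_path_log (γ := γ) (hadj 1)
      have : Y (0 + 1) = cle γ s(c 1, c (1 + 1)) := by
        rw [hYs]; simp [Y, ed]
      rw [this]
      exact ⟨g, h1, fun x hx => by rw [h2 x hx]; norm_num⟩
    | succ m ih =>
      obtain ⟨g, h1, h2⟩ := ih
      obtain ⟨g', h1', h2'⟩ := cle_path_log (γ := γ) (hadj (m + 2))
      have hY : Y (m + 1 + 1) = Y (m + 1) ∪ cle γ s(c (m + 2), c (m + 2 + 1)) := by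
        rw [hYs (m + 1)]
        have : ((m + 1 : ℕ) : ℤ) + 1 = m + 2 := by push_cast; ring
        simp only [ed, this]
      refine ⟨fun x => g x + g' x, ?_, ?_⟩
      · apply ContinuousOn.add
        · exact h1.mono (by rw [hY]; exact compl_subset_compl.2 subset_union_left)
        · exact h1'.mono (by rw [hY]; exact compl_subset_compl.2 subset_union_right)
      · intro x hx
        rw [hY] at hx
        simp only [mem_union, not_or] at hx
        have hx0 : zc x - zc (γ.vmap (c (m + 2))) ≠ 0 := by
          apply zc_ne
          rintro rfl
          exact hx.2 (vmap_mem_cle γ (by simp))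
        rw [Complex.exp_add, h2 x hx.1, h2' x hx.2]
        have : ((m + 1 : ℕ) : ℤ) + 2 = m + 2 + 1 := by push_cast; ring
        rw [this]
        field_simp
  obtain ⟨m, hm⟩ : ∃ m, n = m + 2 := ⟨n - 2, by omega⟩
  have hcn : c (m + 2) = c 0 := by
    have := hc.periodic 0 1
    rw [← this, hm]; congr 1; push_cast; ring
  obtain ⟨gY, cY, eY⟩ := hlog m
  rw [hcn] at eY
  obtain ⟨gX, cX, eX⟩ := cle_path_log (γ := γ) (hadj 0).symm
  set X := cle γ s(c (0 + 1), c 0) with hX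
  have hXe : X = cle γ (ed 0) := by rw [hX, Sym2.eq_swap]
  have hYc : IsClosed (Y (m + 1)) := isClosed_iUnion_of_finite fun i => (cle_compact γ (hed _)).isClosed
  have h01 : c 0 ≠ c 1 := (hadj 0).ne
  have hXYi : X ∩ Y (m + 1) = {γ.vmap (c 0), γ.vmap (c 1)} := by
    apply subset_antisymm
    · rintro x ⟨hx, hx'⟩
      rw [hXe] at hx
      obtain ⟨i, hi⟩ := mem_iUnion.1 hx'
      have hne : ed 0 ≠ ed (i.1 + 1) := by
        intro h
        simp only [ed, zero_add, Sym2.eq_iff, hc.eq_iff] at h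
        have hi2 := i.2
        rcases h with ⟨h, _⟩ | ⟨_, h⟩
        · have := Int.le_of_dvd (by omega) h
          omega
        · rw [add_sub_cancel_right] at h
          rcases Nat.eq_zero_or_pos i.1 with h0 | h0
          · rename_i h'
            rw [h0] at h'
            have := Int.le_of_dvd (by norm_num) h'
            omega
          · have := Int.le_of_dvd (by omega) h
            omega
      obtain ⟨v, hv, _, rfl⟩ := cle_inter hpl (hed _) (hed _) hne hx hi
      simp only [ed, Sym2.mem_iff] at hv
      rcases hv with rfl | rfl
      · exact Or.inl rfl
      · exact Or.inr rfl
    · rintro x (rfl | rfl)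
      · refine ⟨vmap_mem_cle γ (by simp), hYmem (m + 1) m (by omega) (vmap_mem_cle γ ?_)⟩
        have : (m : ℤ) + 1 + 1 = m + 2 := by ring
        simp only [ed, this, hcn, Sym2.mem_iff, or_true]
      · refine ⟨vmap_mem_cle γ (by simp), hYmem (m + 1) 0 (by omega) (vmap_mem_cle γ ?_)⟩
        simp [ed]
  have hcover : ∀ i, cle γ (ed i) ⊆ X ∪ Y (m + 1) := by
    intro i
    have hn0 : (0:ℤ) < n := by omega
    have h1 := Int.emod_nonneg i hn0.ne'
    have h2 := Int.emod_lt_of_pos i hn0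
    have h3 : ed i = ed (i % n) := by
      have e1 : c i = c (i % n) := by
        conv_lhs => rw [← Int.emod_add_mul_ediv i n]
        exact hc.periodic _ _
      have e2 : c (i + 1) = c (i % n + 1) := by
        rw [← hc.periodic (i % n + 1) (i / n)]
        congr 1
        have := Int.emod_add_mul_ediv i n
        linarith
      simp only [ed, e1, e2]
    rw [h3]
    obtain ⟨r, hr⟩ := Int.eq_ofNat_of_zero_le h1
    rw [hr] at h2 ⊢
    rcases r with _ | r
    · rw [hXe]; exact subset_union_left
    · refine subset_trans ?_ subset_union_right
      have := hYmem (m + 1) r (by omega)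
      push_cast; exact this
  have hXY : X ∪ Y (m + 1) = γ.image C := by
    apply subset_antisymm
    · rw [hXe]
      apply union_subset (cle_subset γ (hc.adj 0))
      exact iUnion_subset fun i => cle_subset γ (hc.adj _)
    · refine (image_eq γ C).subset.trans ?_
      apply union_subset
      · rintro _ ⟨v, hv, rfl⟩
        obtain ⟨i, rfl⟩ := hc.surj v hv
        exact hcover i (vmap_mem_cle γ (by simp [ed]))
      · refine iUnion₂_subset fun e he => ?_
        obtain ⟨i, rfl⟩ := hc.edge he
        exact hcover i
  rw [← hXY] at hne ⊢
  exact separation (cle_compact γ (hadj 0).symm).isClosed hYc (γ.vmap_inj.ne h01) hXYi hne cX cY eX eY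

end jordan

section fill
variable {V : Type} {H : SimpleGraph V} {γ : Drawing H}

lemma no_filling [Finite V] {C : H.Subgraph} {O : Set Plane} (hO : IsOuter γ O)
    (hOC : frontier O = γ.image C) {p : Plane} (hpO : p ∉ O) (E : Plane → ℂ)
    (hE : ContinuousOn E (γ.image ⊤)) (hE0 : ∀ x ∈ γ.image ⊤, E x ≠ 0)
    (hEC : ∀ x ∈ γ.image C, E x = zc x - zc p)
    (hF : ∀ F ∈ γ.faces, F ≠ O → ∃ T : H.Subgraph, frontier F = γ.image T ∧
      ∃ L : Plane → ℂ, ContinuousOn L (γ.image T) ∧ ∀ x ∈ γ.image T, Complex.exp (L x) = E x) :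
    False := by
  classical
  have hF' : ∀ F, ∃ T : H.Subgraph, ∃ G : Plane → ℂ, F ∈ γ.faces → F ≠ O → frontier F = γ.image T ∧
      Continuous G ∧ ∀ x ∈ γ.image T, Complex.exp (G x) = E x := by
    intro F
    by_cases h : F ∈ γ.faces ∧ F ≠ O
    · obtain ⟨T, h1, L, h2, h3⟩ := hF F h.1 h.2
      obtain ⟨G, hG, hG2⟩ := tietze (image_compact γ T).isClosed h2
      exact ⟨T, G, fun _ _ => ⟨h1, hG, fun x hx => by rw [hG2 x hx, h3 x hx]⟩⟩
    · exact ⟨⊤, 0, fun h1 h2 => absurd ⟨h1, h2⟩ h⟩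
  choose Tf hTf using hF'
  -- one function for each triangle
  have hG : ∀ T : H.Subgraph, ∃ G : Plane → ℂ, (∃ F ∈ γ.faces, F ≠ O ∧ Tf F = T) →
      Continuous G ∧ ∀ x ∈ γ.image T, Complex.exp (G x) = E x := by
    intro T
    by_cases h : ∃ F ∈ γ.faces, F ≠ O ∧ Tf F = T
    · obtain ⟨F, h1, h2, rfl⟩ := h
      obtain ⟨G, hG⟩ := hTf F
      exact ⟨G, fun _ => (hG h1 h2).2⟩
    · exact ⟨0, fun h' => absurd h' h⟩
  choose G hG using hG
  have htop : ∀ S' : H.Subgraph, γ.image S' ⊆ γ.image ⊤ := fun S' => image_mono γ le_top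
  let Φ : Plane → ℂ := fun x => if x ∈ γ.image ⊤ then E x else if x ∈ O then zc x - zc p else
    Complex.exp (G (Tf (connectedComponentIn γ.totalImageᶜ x)) x)
  have hΦX : ∀ x ∈ γ.image ⊤, Φ x = E x := fun x hx => by simp only [Φ, hx, if_true]
  have hΦO : ∀ x ∈ O, Φ x = zc x - zc p := fun x hx => by
    simp only [Φ, face_sub hO.face hx, if_false, hx, if_true]
  have hΦF : ∀ F ∈ γ.faces, F ≠ O → ∀ x ∈ F, Φ x = Complex.exp (G (Tf F) x) := by
    intro F hF hne x hx
    have h1 : x ∉ O := fun h => hne (face_unique hF hO.face hx h)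
    have h2 := face_sub hF hx
    have h3 : connectedComponentIn γ.totalImageᶜ x = F := by
      obtain ⟨y, hy, rfl⟩ := hF
      exact (connectedComponentIn_eq hx).symm
    simp only [Φ, h1, h2, if_false, h3]
  let K : {T : H.Subgraph // ∃ F ∈ γ.faces, F ≠ O ∧ Tf F = T} → Set Plane := fun T =>
    ⋃₀ {F | F ∈ γ.faces ∧ F ≠ O ∧ Tf F = T.1} ∪ γ.image T.1
  have hKc : ∀ T, IsClosed (K T) := by
    intro T
    apply closure_sUnion_comp (image_compact γ T.1).isClosed
    rintro F ⟨h1, h2, h3⟩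
    obtain ⟨G, hG⟩ := hTf F
    rw [(hG h1 h2).1, h3]
  have hKΦ : ∀ T, ContinuousOn Φ (K T) := by
    intro T
    obtain ⟨hGc, hGe⟩ := hG T.1 T.2
    have : ContinuousOn (fun x => Complex.exp (G T.1 x)) (K T) := (Complex.continuous_exp.comp hGc).continuousOn
    refine this.congr ?_
    rintro x (⟨F, ⟨h1, h2, h3⟩, hx⟩ | hx)
    · rw [hΦF F h1 h2 x hx, h3]
    · rw [hΦX x (htop _ hx)]; exact (hGe x hx).symm
  have hzc := zc_cont
  have hOcl : IsClosed (O ∪ γ.image C) := by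
    have := closure_sUnion_comp (FF := {O}) (image_compact γ C).isClosed (by
      rintro F rfl; exact hOC.subset)
    simpa using this
  have hΦO' : ContinuousOn Φ (O ∪ γ.image C) := by
    have : ContinuousOn (fun x => zc x - zc p) (O ∪ γ.image C) := by fun_prop
    refine this.congr ?_
    rintro x (hx | hx)
    · exact hΦO x hx
    · rw [hΦX x (htop _ hx), hEC x hx]
  have hXc := (image_compact γ ⊤).isClosed
  have hcont : Continuous Φ := by
    rw [← continuousOn_univ]
    have huniv : (univ : Set Plane) = (γ.image ⊤ ∪ (O ∪ γ.image C)) ∪ ⋃ T, K T := by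
      symm
      rw [eq_univ_iff_forall]
      intro x
      by_cases hx : x ∈ γ.image ⊤
      · exact Or.inl (Or.inl hx)
      · obtain ⟨F, hF, hxF⟩ := exists_face hx
        by_cases hFO : F = O
        · exact Or.inl (Or.inr (Or.inl (hFO ▸ hxF)))
        · exact Or.inr (mem_iUnion.2 ⟨⟨Tf F, F, hF, hFO, rfl⟩, Or.inl ⟨F, ⟨hF, hFO, rfl⟩, hxF⟩⟩)
    rw [huniv]
    apply ContinuousOn.union_of_isClosed
    · exact ContinuousOn.union_of_isClosed (hE.congr hΦX) hΦO' hXc hOcl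
    · exact LocallyFinite.continuousOn_iUnion (locallyFinite_of_finite _) hKc hKΦ
    · exact hXc.union hOcl
    · exact isClosed_iUnion_of_finite hKc
  apply no_ext p Φ hcont _ Oᶜ hO.compl_bdd
  · intro x hx
    exact hΦO x (not_not.1 hx)
  · intro x
    by_cases hx : x ∈ γ.image ⊤
    · rw [hΦX x hx]; exact hE0 x hx
    · obtain ⟨F, hF, hxF⟩ := exists_face hx
      by_cases hFO : F = O
      · subst hFO
        rw [hΦO x hxF]
        apply zc_ne
        rintro rfl
        exact hpO hxF
      · rw [hΦF F hF hFO x hxF]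
        exact Complex.exp_ne_zero _

lemma exists_antidiff (Δ : ℤ → ℂ) (x0 : ℂ) : ∃ l : ℤ → ℂ, l 0 = x0 ∧ ∀ j, l (j + 1) = l j + Δ j := by
  refine ⟨fun j => x0 + ∑ i ∈ Finset.range j.toNat, Δ i -
    ∑ i ∈ Finset.range (-j).toNat, Δ (-(i:ℤ) - 1), by simp, ?_⟩
  intro j
  rcases le_or_gt 0 j with h | h
  · obtain ⟨m, rfl⟩ := Int.eq_ofNat_of_zero_le h
    have h1 : ((m:ℤ) + 1).toNat = m + 1 := by omega
    have h2 : (-((m:ℤ) + 1)).toNat = 0 := by omega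
    have h3 : (-(m:ℤ)).toNat = 0 := by omega
    have h4 : (m:ℤ).toNat = m := by omega
    simp only [h1, h2, h3, h4, Finset.sum_range_succ]
    simp; ring
  · obtain ⟨m, hm⟩ : ∃ m : ℕ, j = -(m:ℤ) - 1 := ⟨(-j - 1).toNat, by omega⟩
    subst hm
    have h1 : (-(m:ℤ) - 1 + 1).toNat = 0 := by omega
    have h2 : (-(-(m:ℤ) - 1 + 1)).toNat = m := by omega
    have h3 : (-(-(m:ℤ) - 1)).toNat = m + 1 := by omega
    have h4 : (-(m:ℤ) - 1).toNat = 0 := by omega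
    simp only [h1, h2, h3, h4, Finset.sum_range_succ]
    ring

end fill

section deep
variable {V : Type} {H : SimpleGraph V} {γ : Drawing H}

lemma no_retraction [Finite V] (hpl : γ.crossings = ∅) {k : ℕ} (hk : 1 ≤ k)
    {C : H.Subgraph} (hC : IsCycleSubgraph C) (hC8k : C.verts.ncard = 8 * k)
    {O : Set Plane} (hO : IsOuter γ O) (hOC : frontier O = γ.image C)
    (hneartri : ∀ F ∈ γ.faces, IsBounded F →
      ∃ T : H.Subgraph, IsCycleSubgraph T ∧ T.verts.ncard = 3 ∧ frontier F = γ.image T)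
    (hdist : ∀ u v : C.verts, H.dist (u : V) (v : V) = C.coe.dist u v)
    (f : V → V) (hfC : ∀ v, f v ∈ C.verts) (hfix : ∀ v ∈ C.verts, f v = v)
    (hnear : ∀ u v, H.Adj u v → H.dist (f u) (f v) + 1 ≤ 2 * k) : False := by
  obtain ⟨c, hc⟩ := exists_param hC
  rw [hC8k] at hc
  have htop : ∀ S' : H.Subgraph, γ.image S' ⊆ γ.image ⊤ := fun S' => image_mono γ le_top
  -- a point separated from infinity
  obtain ⟨p, hpC, hpO⟩ : ∃ p, p ∉ γ.image C ∧ p ∉ O := by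
    by_contra! hcon
    have hsub : O ⊆ (γ.image C)ᶜ := fun x hx hx' => face_sub hO.face hx (htop _ hx')
    have heq : O = (γ.image C)ᶜ := subset_antisymm hsub fun x hx => hcon x hx
    have hne : ((γ.image C)ᶜ).Nonempty := heq ▸ face_nonempty hO.face
    apply jordan hpl (by omega) hc hne
    rw [← heq]
    exact face_pre hO.face
  -- closeness relation
  let R : V → V → ℤ → ℤ → Prop := fun u v a b => c a = f u ∧ c b = f v ∧ |b - a| + 1 ≤ 2 * k
  have hRex : ∀ u v, H.Adj u v → ∀ a, c a = f u → ∃ b, R u v a b := by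
    intro u v huv a ha
    have h1 := hnear u v huv
    have h2 := hdist ⟨f u, hfC u⟩ ⟨f v, hfC v⟩
    obtain ⟨w, hw⟩ := (hC.1.coe.preconnected ⟨f u, hfC u⟩ ⟨f v, hfC v⟩).exists_walk_length_eq_dist
    obtain ⟨b, hb, hab⟩ := hc.lift w a ha
    refine ⟨b, ha, hb, ?_⟩
    rw [hw, ← h2] at hab
    have : ((H.dist (f u) (f v) : ℕ) : ℤ) + 1 ≤ 2 * k := by exact_mod_cast h1
    simp only at hab
    linarith
  have hRsymm : ∀ u v a b, R u v a b → R v u b a := by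
    rintro u v a b ⟨h1, h2, h3⟩
    exact ⟨h2, h1, by rwa [abs_sub_comm]⟩
  have hkZ : (1:ℤ) ≤ k := by exact_mod_cast hk
  have huniq : ∀ i j : ℤ, c i = c j → |j - i| < 8 * k → i = j := by
    intro i j h hlt
    rw [hc.eq_iff] at h
    have := Int.eq_zero_of_abs_lt_dvd h (by push_cast; exact hlt)
    omega
  -- logarithms along the cycle
  have hClog : ∀ e ∈ C.edgeSet, HasLog p (cle γ e) := fun e he =>
    cle_hasLog γ (C.edgeSet_subset he) (fun h => hpC (cle_subset γ he h))
  choose! g0 hg0c hg0e using hClog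
  have hx0 : zc (γ.vmap (c 0)) - zc p ≠ 0 := by
    apply zc_ne
    rintro rfl
    exact hpC (vmap_mem_image.2 (hc.mem 0))
  obtain ⟨l, hl0, hls⟩ := exists_antidiff (fun j => g0 s(c j, c (j + 1)) (γ.vmap (c (j + 1))) -
    g0 s(c j, c (j + 1)) (γ.vmap (c j))) (Complex.log (zc (γ.vmap (c 0)) - zc p))
  have hedge : ∀ j, s(c j, c (j + 1)) ∈ C.edgeSet := fun j => hc.adj j
  have hlstep : ∀ j, Complex.exp (l (j + 1)) = Complex.exp (l j) *
      ((zc (γ.vmap (c (j + 1))) - zc p) / (zc (γ.vmap (c j)) - zc p)) := by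
    intro j
    rw [hls, Complex.exp_add, Complex.exp_sub, hg0e _ (hedge j) _ (vmap_mem_cle γ (by simp)),
      hg0e _ (hedge j) _ (vmap_mem_cle γ (by simp))]
  have hcne : ∀ j, zc (γ.vmap (c j)) - zc p ≠ 0 := by
    intro j
    apply zc_ne
    rintro rfl
    exact hpC (vmap_mem_image.2 (hc.mem j))
  have hlexp : ∀ j, Complex.exp (l j) = zc (γ.vmap (c j)) - zc p := by
    intro j
    induction j using Int.induction_on with
    | zero => rw [hl0, Complex.exp_log hx0]
    | succ i ih =>
      rw [hlstep, ih, mul_div_cancel₀ _ (hcne _)]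
    | pred i ih =>
      have h1 := hlstep (-(i:ℤ) - 1)
      rw [sub_add_cancel, ih] at h1
      have h2 := hcne (-(i:ℤ) - 1)
      have h3 := hcne (-(i:ℤ))
      field_simp at h1
      exact h1.symm
  have hlper : ∀ t a, l (a + (8 * k : ℕ) * t) - l a = l (0 + (8 * k : ℕ) * t) - l 0 := by
    intro t a
    have hst : ∀ j, l (j + 1 + (8 * k : ℕ) * t) - l (j + 1) = l (j + (8 * k : ℕ) * t) - l j := by
      intro j
      have e : j + 1 + (8 * k : ℕ) * t = j + (8 * k : ℕ) * t + 1 := by ring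
      rw [e, hls, hls]
      have e1 := hc.periodic j t
      have e2 := hc.periodic (j + 1) t
      rw [e] at e2
      simp only [e1, e2]
      ring
    induction a using Int.induction_on with
    | zero => rfl
    | succ i ih => rw [hst, ih]
    | pred i ih =>
      have := hst (-(i:ℤ) - 1)
      rw [sub_add_cancel, ih] at this
      exact this.symm
  have hwd : ∀ u v a b a' b', R u v a b → R u v a' b' → l b - l a = l b' - l a' := by
    rintro u v a b a' b' ⟨h1, h2, h3⟩ ⟨h1', h2', h3'⟩
    obtain ⟨t, ht⟩ := (hc.eq_iff a a').1 (h1.trans h1'.symm)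
    have ha' : a' = a + (8 * k : ℕ) * t := by linarith
    have hb' : b' = b + (8 * k : ℕ) * t := by
      apply huniq
      · rw [hc.periodic, h2, h2']
      · have : b + (8 * k : ℕ) * t - b' = (b - a) + -(b' - a') := by rw [ha']; ring
        have h4 := abs_add_le (b - a) (-(b' - a'))
        rw [← this, abs_neg] at h4
        linarith
    rw [ha', hb']
    linear_combination hlper t a - hlper t b
  -- functions on edges
  have hge : ∀ e ∈ H.edgeSet, ∃ g : Plane → ℂ, ContinuousOn g (cle γ e) ∧
      (∀ u v, e = s(u, v) → ∀ a b, R u v a b → g (γ.vmap v) - g (γ.vmap u) = l b - l a) ∧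
      (∀ v ∈ e, Complex.exp (g (γ.vmap v)) = zc (γ.vmap (f v)) - zc p) ∧
      (e ∈ C.edgeSet → ∀ x ∈ cle γ e, Complex.exp (g x) = zc x - zc p) := by
    intro e he
    by_cases heC : e ∈ C.edgeSet
    · refine ⟨g0 e, hg0c e heC, ?_, ?_, fun _ => hg0e e heC⟩
      · rintro u v rfl a b ⟨ha, hb, hab⟩
        have huv : C.Adj u v := heC
        rw [hfix u (C.edge_vert huv)] at ha
        rw [hfix v (C.edge_vert huv.symm)] at hb
        subst ha hb
        have hab' := abs_le.1 (show |b - a| ≤ 2 * k - 1 by linarith)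
        rcases hc.nbr a _ huv with h | h
        · have hb := huniq b (a + 1) h (by rw [abs_lt]; constructor <;> linarith)
          rw [hb, hls]; ring
        · have hb := huniq b (a - 1) h (by rw [abs_lt]; constructor <;> linarith)
          have h1 := hls (a - 1)
          rw [sub_add_cancel] at h1
          rw [hb, h1, Sym2.eq_swap]; ring
      · intro v hv
        rw [hfix v (C.mem_verts_of_mem_edge heC hv)]
        exact hg0e e heC _ (vmap_mem_cle γ hv)
    · induction e with
      | h u v =>
        have huv : H.Adj u v := he
        obtain ⟨a, ha⟩ := hc.surj (f u) (hfC u)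
        obtain ⟨b, hR⟩ := hRex u v huv a ha
        obtain ⟨g, hg, hgu, hgv⟩ := cle_interp γ huv (l a) (l b)
        refine ⟨g, hg, ?_, ?_, fun h => absurd h heC⟩
        · intro u' v' h a' b' hR'
          rcases Sym2.eq_iff.1 h with ⟨rfl, rfl⟩ | ⟨rfl, rfl⟩
          · rw [hgu, hgv]; exact hwd _ _ _ _ _ _ hR hR'
          · rw [hgu, hgv]; exact hwd _ _ _ _ _ _ (hRsymm _ _ _ _ hR) hR'
        · intro w hw
          rcases Sym2.mem_iff.1 hw with rfl | rfl
          · rw [hgu, hlexp, ha]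
          · rw [hgv, hlexp, hR.2.1]
  choose! g hgc hgd hgv hgC using hge
  have hfne : ∀ v, zc (γ.vmap (f v)) - zc p ≠ 0 := by
    intro v
    apply zc_ne
    rintro rfl
    exact hpC (vmap_mem_image.2 (hfC v))
  obtain ⟨E, hEc, hEv, hEe⟩ := glue hpl (⊤ : H.Subgraph) (fun v => zc (γ.vmap (f v)) - zc p)
    (fun e x => Complex.exp (g e x))
    (fun e he => Complex.continuous_exp.comp_continuousOn (hgc e (by simpa using he)))
    (fun e he v hv => hgv e (by simpa using he) v hv)
  have hcase : ∀ (S : H.Subgraph) (P : Plane → Prop), (∀ v ∈ S.verts, P (γ.vmap v)) →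
      (∀ e ∈ S.edgeSet, ∀ x ∈ cle γ e, P x) → ∀ x ∈ γ.image S, P x := by
    intro S P h1 h2 x hx
    rw [image_eq] at hx
    rcases hx with ⟨v, hv, rfl⟩ | hx
    · exact h1 v hv
    · simp only [mem_iUnion] at hx
      obtain ⟨e, he, hx⟩ := hx
      exact h2 e he x hx
  have hEe' : ∀ e ∈ H.edgeSet, ∀ x ∈ cle γ e, E x = Complex.exp (g e x) :=
    fun e he x hx => hEe e (by simpa using he) x hx
  apply no_filling hO hOC hpO E hEc
  · apply hcase
    · intro v hv; rw [hEv v hv]; exact hfne v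
    · intro e he x hx
      rw [hEe e he x hx]; exact Complex.exp_ne_zero _
  · apply hcase
    · intro v hv
      rw [hEv v trivial, hfix v hv]
    · intro e he x hx
      rw [hEe' e (C.edgeSet_subset he) x hx]
      exact hgC e (C.edgeSet_subset he) he x hx
  · intro F hF hFO
    obtain ⟨T, hT, hT3, hFT⟩ := hneartri F hF (hO.bdd F hF hFO)
    refine ⟨T, hFT, ?_⟩
    obtain ⟨u, hu⟩ := hT.1.nonempty
    obtain ⟨a, ha⟩ := hc.surj (f u) (hfC u)
    have hb : ∀ x, ∃ b, x ∈ T.verts → R u x a b := by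
      intro x
      by_cases hx : x ∈ T.verts
      · by_cases hux : u = x
        · subst hux
          exact ⟨a, fun _ => ⟨ha, ha, by rw [sub_self, abs_zero]; linarith⟩⟩
        · obtain ⟨b, hb⟩ := hRex u x (T.adj_sub (triangle_adj hT hT3 hu hx hux)) a ha
          exact ⟨b, fun _ => hb⟩
      · exact ⟨0, fun h => absurd h hx⟩
    choose b hb using hb
    obtain ⟨L, hLc, hLv, hLe⟩ := log_system hpl T g (fun e he => hgc e (T.edgeSet_subset he))
      (fun x => l (b x)) (by
        intro x y hxy
        obtain ⟨_, hx, hx'⟩ := hb x (T.edge_vert hxy)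
        obtain ⟨_, hy, hy'⟩ := hb y (T.edge_vert hxy.symm)
        obtain ⟨b', hb'⟩ := hRex x y (T.adj_sub hxy) (b x) hx
        have : b' = b y := by
          apply huniq _ _ (hb'.2.1.trans hy.symm)
          have h3 := hb'.2.2
          have h1 := abs_le.1 (show |b x - a| ≤ 2 * k - 1 by linarith)
          have h2 := abs_le.1 (show |b y - a| ≤ 2 * k - 1 by linarith)
          have h4 := abs_le.1 (show |b' - b x| ≤ 2 * k - 1 by linarith)
          rw [abs_lt]; constructor <;> linarith
        rw [this] at hb'
        exact (hgd _ (T.adj_sub hxy) x y rfl _ _ hb').symm)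
    refine ⟨L, hLc, ?_⟩
    have hval : ∀ v ∈ T.verts, Complex.exp (l (b v)) = zc (γ.vmap (f v)) - zc p := by
      intro v hv
      rw [hlexp, (hb v hv).2.1]
    apply hcase
    · intro v hv
      rw [hLv v hv, hEv v trivial, hval v hv]
    · intro e he x hx
      have heH := T.edgeSet_subset he
      have hu := Sym2.out_fst_mem e
      rw [hLe e he x hx _ hu, hEe' e heH x hx, Complex.exp_add, Complex.exp_sub,
        hval _ (T.mem_verts_of_mem_edge he hu), hgv e heH _ hu, div_self (hfne _), mul_one]

lemma exists_level [Finite V] (hconn : H.Connected) (C : H.Subgraph) (hne : C.verts.Nonempty) :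
    ∃ f : V → V, (∀ v, f v ∈ C.verts) ∧ (∀ v ∈ C.verts, f v = v) ∧
      IsLevel C (fun v => H.dist v (f v)) := by
  have hex : ∀ v, ∃ w ∈ C.verts, ∀ w' ∈ C.verts, H.dist v w ≤ H.dist v w' := fun v =>
    Set.exists_min_image C.verts (fun w => H.dist v w) (Set.toFinite _) hne
  choose f hf hmin using hex
  have hfix : ∀ v ∈ C.verts, f v = v := by
    intro v hv
    have := hmin v v hv
    rw [SimpleGraph.dist_self, Nat.le_zero] at this
    exact (hconn.dist_eq_zero_iff.1 this).symm
  refine ⟨f, hf, hfix, ?_, ?_, ?_⟩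
  · intro v
    constructor
    · intro h
      rw [hconn.dist_eq_zero_iff.1 h]; exact hf v
    · intro h
      simp only [hfix v h, SimpleGraph.dist_self]
  · intro u v huv
    have h1 := hmin u (f v) (hf v)
    have h2 := hconn.dist_triangle (u := u) (v := v) (w := f v)
    have h3 := SimpleGraph.dist_eq_one_iff_adj.2 huv
    omega
  · intro v j hj
    obtain ⟨w, hw⟩ := hconn.exists_walk_length_eq_dist v (f v)
    rw [hj] at hw
    have hfv := hf v
    have hmin' := hmin v
    generalize f v = y at w hw hj hfv hmin'
    cases w with
    | nil => simp at hw
    | @cons _ x _ h p =>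
      rw [SimpleGraph.Walk.length_cons] at hw
      refine ⟨x, h.symm, ?_⟩
      have h1 := hmin x y hfv
      have h2 := SimpleGraph.dist_le p
      have h3 := hmin' (f x) (hf x)
      have h4 := hconn.dist_triangle (u := v) (v := x) (w := f x)
      have h5 := SimpleGraph.dist_eq_one_iff_adj.2 h
      omega

end deep

/-- **from the proof of Lemma 3.** Let `k ≥ 1` and let `H` be a plane
near-triangulation (a simple connected plane graph all of whose bounded faces are
bounded by triangles) whose outer (unbounded) face is bounded by a cycle `C` with
exactly `8k` vertices, such that for every pair of vertices `u, v` of `C` the distance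
between `u` and `v` in `H` equals their distance along the cycle `C`. Then `H`
contains a `0`-nest of size `k`: cycles `C₁, …, C_k`, pairwise vertex-disjoint, with
`C_{i+1}` contained in the closed disk bounded by `C_i` for each `i`. -/
theorem statement11 {V : Type} [Fintype V] (k : ℕ) (hk : 1 ≤ k)
    (H : SimpleGraph V) (γ : Drawing H)
    (hplane : γ.crossings = ∅) (hconn : H.Connected)
    (hneartri : ∀ F ∈ γ.faces, IsBounded F →
      ∃ T : H.Subgraph, IsCycleSubgraph T ∧ T.verts.ncard = 3 ∧
        frontier F = γ.image T)
    (C : H.Subgraph) (hC : IsCycleSubgraph C) (hC8k : C.verts.ncard = 8 * k)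
    (houter : ∀ F ∈ γ.faces, ¬ IsBounded F → frontier F = γ.image C)
    (hdist : ∀ u v : C.verts, H.dist (u : V) (v : V) = C.coe.dist u v) :
    ∃ D : Fin k → H.Subgraph,
      (∀ i, IsCycleSubgraph (D i)) ∧
      (∀ i j, i ≠ j → Disjoint (D i).verts (D j).verts) ∧
      (∀ i : ℕ, ∀ h : i + 1 < k,
        γ.image (D ⟨i + 1, h⟩) ⊆ closedRegion (γ.image (D ⟨i, by omega⟩))) := by
  obtain ⟨O, hO⟩ := exists_outer γ
  have hOC := houter O hO.face hO.unbdd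
  obtain ⟨f, hfC, hfix, hlev⟩ := exists_level hconn C hC.1.nonempty
  by_cases hdeep : ∃ v, k ≤ H.dist v (f v)
  · obtain ⟨v, hv⟩ := hdeep
    exact main_of_deep hplane hlev hO hOC hneartri k v hv
  · push Not at hdeep
    exfalso
    refine no_retraction hplane hk hC hC8k hO hOC hneartri hdist f hfC hfix ?_
    intro u v huv
    have h1 := hdeep u
    have h2 := hdeep v
    have h3 := hconn.dist_triangle (u := f u) (v := u) (w := f v)
    have h4 := hconn.dist_triangle (u := u) (v := v) (w := f v)
    have h5 := SimpleGraph.dist_eq_one_iff_adj.2 huv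
    have h6 := SimpleGraph.dist_comm (G := H) (u := f u) (v := u)
    omega

end CrossingPaper
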